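/- For every regular r-multipartition μ ∈ P^r_N and every λ ∈ P^r_N with λ ≥ μ in the dominance order, the multivariable Kostka–Shoji polynomial K_{λμ}(t_1,…,t_r) has nonnegative integer coefficients, i.e. K_{λμ}(t_1,…,t_r) ∈ ℕ[t_1,…,t_r]. -/

import Mathlib

open scoped BigOperators

namespace KS

/-- A pseudoroot pair `(m, n)`: `1 ≤ m < n ≤ rN` and `n ≡ m + 1 (mod r)`. -/
def PseudoPair (r N : ℕ) (p : ℕ × ℕ) : Prop :=
  1 ≤ p.1 ∧ p.1 < p.2 ∧ p.2 ≤ r * N ∧ p.2 % r = (p.1 + 1) % r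

instance (r N : ℕ) : DecidablePred (PseudoPair r N) := fun p => by
  unfold PseudoPair; infer_instance

/-- The finite set of all pseudoroot pairs. -/
def pseudoPairs (r N : ℕ) : Finset (ℕ × ℕ) :=
  (Finset.range (r * N + 1) ×ˢ Finset.range (r * N + 1)).filter (PseudoPair r N)

/-- Standard basis vector `e_m` of `ℤ^{rN}` (1-based index `m`). -/
def stdVec (r N : ℕ) (m : ℕ) : Fin (r * N) → ℤ :=
  fun i => if (i : ℕ) + 1 = m then 1 else 0

/-- The vector `e_m - e_n` associated to a pseudoroot pair `(m, n)`. -/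
def prVec (r N : ℕ) (p : ℕ × ℕ) : Fin (r * N) → ℤ :=
  stdVec r N p.1 - stdVec r N p.2

/-- `M` is a decomposition of `β` into pseudoroot pairs. -/
def IsDecomp (r N : ℕ) (β : Fin (r * N) → ℤ) (M : Multiset (ℕ × ℕ)) : Prop :=
  (∀ p ∈ M, PseudoPair r N p) ∧ (M.map (prVec r N)).sum = β

/-- `d_s(M)`: number of elements `(m,n)` of `M` with `m ≡ s (mod r)`,
where `s : Fin r` encodes the residue `s + 1 ∈ {1, …, r}`. -/
def dCount (r : ℕ) (M : Multiset (ℕ × ℕ)) (s : Fin r) : ℕ :=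
  Multiset.card (M.filter (fun p => p.1 % r = ((s : ℕ) + 1) % r))

/-- The monomial `∏_s t_s ^ (d_s M)`. -/
noncomputable def dMono (r : ℕ) (M : Multiset (ℕ × ℕ)) : MvPolynomial (Fin r) ℤ :=
  ∏ s : Fin r, (MvPolynomial.X s) ^ (dCount r M s)

/-- The multivariable partition function `L^β(t_1, …, t_r)`. -/
noncomputable def Lmv (r N : ℕ) (β : Fin (r * N) → ℤ) : MvPolynomial (Fin r) ℤ :=
  ∑ᶠ M ∈ {M : Multiset (ℕ × ℕ) | IsDecomp r N β M}, dMono r M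

/-- The one-variable partition function `L^β(t)`. -/
noncomputable def Lone (r N : ℕ) (β : Fin (r * N) → ℤ) : Polynomial ℤ :=
  ∑ᶠ M ∈ {M : Multiset (ℕ × ℕ) | IsDecomp r N β M},
    (Polynomial.X : Polynomial ℤ) ^ (Multiset.card M)

/-- The position of the entry `λ^{(s)}_j` in the interleaved order: the
0-based index `r * j + s` (for 0-based `s : Fin r`, `j : Fin N`) corresponds
to the 1-based index `r(j − 1) + s`. -/
def pos (r N : ℕ) (s : Fin r) (j : Fin N) : Fin (r * N) :=
  ⟨r * (j : ℕ) + (s : ℕ), by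
    have hs : (s : ℕ) < r := s.isLt
    have hj : (j : ℕ) + 1 ≤ N := j.isLt
    have h1 : r * ((j : ℕ) + 1) ≤ r * N := Nat.mul_le_mul (le_refl r) hj
    have h2 : r * ((j : ℕ) + 1) = r * (j : ℕ) + r := by ring
    linarith⟩

theorem fin_aux_r {r N : ℕ} (i : Fin (r * N)) : 0 < r := by
  rcases Nat.eq_zero_or_pos r with h | h
  · exact absurd i.pos (by simp [h])
  · exact h

theorem mod_lt_of_fin {r N : ℕ} (i : Fin (r * N)) : (i : ℕ) % r < r :=
  Nat.mod_lt _ (fin_aux_r i)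

theorem div_lt_of_fin {r N : ℕ} (i : Fin (r * N)) : (i : ℕ) / r < N := by
  have h := i.isLt
  exact (Nat.div_lt_iff_lt_mul (fin_aux_r i)).mpr
    (lt_of_lt_of_le h (le_of_eq (Nat.mul_comm r N)))

/-- The action of `σ ∈ S_N^r` on `ℤ^{rN}`: the `s`-th copy of `S_N` permutes
the coordinates indexed by `r(j−1)+s`, `j = 1, …, N`. -/
def permAct (r N : ℕ) (σ : Fin r → Equiv.Perm (Fin N)) (ν : Fin (r * N) → ℤ) :
    Fin (r * N) → ℤ :=
  fun i =>
    ν (pos r N ⟨(i : ℕ) % r, mod_lt_of_fin i⟩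
        ((σ ⟨(i : ℕ) % r, mod_lt_of_fin i⟩)⁻¹ ⟨(i : ℕ) / r, div_lt_of_fin i⟩))

/-- The multipartition `ρ` with `ρ^{(s)} = (N, N−1, …, 1)` for every `s`. -/
def rhoVec (r N : ℕ) : Fin (r * N) → ℤ :=
  fun i => (N : ℤ) - ((i : ℕ) / r : ℕ)

/-- The sign `(−1)^σ` of `σ ∈ S_N^r`. -/
def signProd (r N : ℕ) (σ : Fin r → Equiv.Perm (Fin N)) : ℤ :=
  ∏ s : Fin r, (Equiv.Perm.sign (σ s) : ℤ)

/-- The multivariable Kostka–Shoji polynomial `K_{λμ}(t_1, …, t_r)`. -/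
noncomputable def Kmv (r N : ℕ) (lam mu : Fin (r * N) → ℤ) : MvPolynomial (Fin r) ℤ :=
  ∑ σ : Fin r → Equiv.Perm (Fin N),
    MvPolynomial.C (signProd r N σ) *
      Lmv r N (permAct r N σ (lam + rhoVec r N) - rhoVec r N - mu)

/-- The one-variable Kostka–Shoji polynomial `K_{λμ}(t)`. -/
noncomputable def Kone (r N : ℕ) (lam mu : Fin (r * N) → ℤ) : Polynomial ℤ :=
  ∑ σ : Fin r → Equiv.Perm (Fin N),
    Polynomial.C (signProd r N σ) *
      Lone r N (permAct r N σ (lam + rhoVec r N) - rhoVec r N - mu)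

/-- `ν ∈ ℤ^{rN}` is (the interleaved vector of) an `r`-multipartition:
each `ν^{(s)}` is weakly decreasing. -/
def IsMP (r N : ℕ) (ν : Fin (r * N) → ℤ) : Prop :=
  ∀ (s : Fin r) (j k : Fin N), j ≤ k → ν (pos r N s k) ≤ ν (pos r N s j)

/-- A regular multipartition: each `ν^{(s)}` is strictly decreasing. -/
def RegularMP (r N : ℕ) (ν : Fin (r * N) → ℤ) : Prop :=
  ∀ (s : Fin r) (j k : Fin N), j < k → ν (pos r N s k) < ν (pos r N s j)

/-- `Σ_n(ν)`: the sum of the first `n` coordinates of `ν` in the interleaved order. -/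
def partialSum (r N : ℕ) (ν : Fin (r * N) → ℤ) (n : ℕ) : ℤ :=
  ∑ i : Fin (r * N), if (i : ℕ) < n then ν i else 0

/-- Dominance order: `λ ≥ μ`. -/
def Dominates (r N : ℕ) (lam mu : Fin (r * N) → ℤ) : Prop :=
  (∀ n : ℕ, 1 ≤ n → n ≤ r * N - 1 → partialSum r N mu n ≤ partialSum r N lam n) ∧
    partialSum r N lam (r * N) = partialSum r N mu (r * N)


section
/-- Laurent polynomials in `N` variables. -/
abbrev LR (N : ℕ) := AddMonoidAlgebra ℤ (Fin N → ℤ)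

noncomputable def mono {N : ℕ} (γ : Fin N → ℤ) : LR N := AddMonoidAlgebra.single γ 1

noncomputable def xv {N : ℕ} (a : Fin N) : LR N := mono (Pi.single a 1)

theorem mono_mul {N : ℕ} (γ δ : Fin N → ℤ) : mono γ * mono δ = mono (γ + δ) := by
  simp [mono, AddMonoidAlgebra.single_mul_single]

theorem mono_zero {N : ℕ} : (mono 0 : LR N) = 1 := rfl

theorem mono_inj {N : ℕ} {γ δ : Fin N → ℤ} (h : (mono γ : LR N) = mono δ) : γ = δ := by
  simpa [mono, AddMonoidAlgebra.single_left_inj] using h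

theorem mono_ne_zero {N : ℕ} (γ : Fin N → ℤ) : (mono γ : LR N) ≠ 0 := by
  simp [mono]

theorem single_eq_smul_mono {N : ℕ} (γ : Fin N → ℤ) (c : ℤ) :
    (AddMonoidAlgebra.single γ c : LR N) = c • mono γ := by
  simp [mono, AddMonoidAlgebra.smul_single]

theorem LR_ind {N : ℕ} (P : LR N → Prop) (h0 : P 0) (hadd : ∀ f g, P f → P g → P (f + g))
    (hneg : ∀ f, P f → P (-f)) (hm : ∀ γ, P (mono γ)) (f : LR N) : P f := by
  let S : AddSubgroup (LR N) :=
    { carrier := {f | P f}, add_mem' := fun {a b} ha hb => hadd a b ha hb, zero_mem' := h0,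
      neg_mem' := fun {a} ha => hneg a ha }
  have : f ∈ S := by
    induction f using AddMonoidAlgebra.induction_linear with
    | zero => exact S.zero_mem
    | add f g hf hg => exact S.add_mem hf hg
    | single γ c =>
      rw [single_eq_smul_mono]
      exact S.zsmul_mem (hm γ) c
  exact this

/-- The linear map with prescribed values on monomials. -/
noncomputable def lin {N : ℕ} {M : Type*} [AddCommGroup M] (F : (Fin N → ℤ) → M) : LR N →ₗ[ℤ] M where
  toFun f := f.coeff.sum (fun γ c => c • F γ)
  map_add' f g := by
    rw [AddMonoidAlgebra.coeff_add, Finsupp.sum_add_index'] <;> simp [add_smul]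
  map_smul' c f := by
    rw [AddMonoidAlgebra.coeff_smul, Finsupp.sum_smul_index' (by simp), Finsupp.smul_sum]
    simp [mul_smul]

theorem lin_mono {N : ℕ} {M : Type*} [AddCommGroup M] (F : (Fin N → ℤ) → M) (γ : Fin N → ℤ) :
    lin F (mono γ) = F γ := by
  simp [lin, mono]

theorem lin_ext {N : ℕ} {M : Type*} [AddCommGroup M] {A B : LR N →ₗ[ℤ] M}
    (h : ∀ γ, A (mono γ) = B (mono γ)) : ∀ f, A f = B f := by
  apply LR_ind
  · simp
  · intro f g hf hg; simp [hf, hg]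
  · intro f hf; simp [hf]
  · exact h

/-- The permutation action. -/
noncomputable def act {N : ℕ} (σ : Equiv.Perm (Fin N)) : LR N →+* LR N :=
  AddMonoidAlgebra.mapDomainRingHom ℤ
    ({ toFun := fun γ j => γ (σ⁻¹ j), map_zero' := rfl, map_add' := fun _ _ => rfl } :
      (Fin N → ℤ) →+ (Fin N → ℤ))

theorem act_mono {N : ℕ} (σ : Equiv.Perm (Fin N)) (γ : Fin N → ℤ) :
    act σ (mono γ) = mono (fun j => γ (σ⁻¹ j)) := by
  simp [act, mono]

theorem act_act {N : ℕ} (σ τ : Equiv.Perm (Fin N)) (f : LR N) :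
    act σ (act τ f) = act (σ * τ) f := by
  revert f
  apply LR_ind
  · simp
  · intro f g hf hg; simp [hf, hg]
  · intro f hf; simp [hf]
  · intro γ; simp [act_mono]

theorem act_one {N : ℕ} (f : LR N) : act 1 f = f := by
  revert f
  apply LR_ind
  · simp
  · intro f g hf hg; simp [hf, hg]
  · intro f hf; simp [hf]
  · intro γ; simp [act_mono]

theorem act_xv {N : ℕ} (σ : Equiv.Perm (Fin N)) (a : Fin N) : act σ (xv a) = xv (σ a) := by
  rw [xv, act_mono, xv]
  congr 1
  ext j
  simp only [Pi.single_apply]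
  congr 1
  rw [eq_iff_iff, Equiv.Perm.inv_eq_iff_eq, eq_comm, eq_comm (a := σ a)]

noncomputable abbrev sw {N : ℕ} (a b : Fin N) : LR N →+* LR N := act (Equiv.swap a b)

theorem sw_sw {N : ℕ} (a b : Fin N) (f : LR N) : sw a b (sw a b f) = f := by
  simp [sw, act_act, act_one]

theorem sw_comm {N : ℕ} (a b : Fin N) (f : LR N) : sw b a f = sw a b f := by
  simp [sw, Equiv.swap_comm]

theorem sw_left {N : ℕ} (a b : Fin N) : sw a b (xv a) = xv b := by simp [sw, act_xv]
theorem sw_right {N : ℕ} (a b : Fin N) : sw a b (xv b) = xv a := by simp [sw, act_xv]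
theorem sw_of_ne {N : ℕ} {a b c : Fin N} (h1 : c ≠ a) (h2 : c ≠ b) : sw a b (xv c) = xv c := by
  simp [sw, act_xv, Equiv.swap_apply_of_ne_of_ne h1 h2]

theorem xv_sub_ne {N : ℕ} {a b : Fin N} (h : a ≠ b) : (xv a - xv b : LR N) ≠ 0 := by
  intro h'
  have := mono_inj (sub_eq_zero.mp h')
  have h2 := congrFun this a
  simp [h] at h2

theorem xv_ne_zero {N : ℕ} (a : Fin N) : (xv a : LR N) ≠ 0 := mono_ne_zero _

theorem xv_pow {N : ℕ} (a : Fin N) (n : ℕ) : (xv a : LR N) ^ n = mono (Pi.single a (n : ℤ)) := by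
  induction n with
  | zero => simp [← mono_zero]
  | succ n ih =>
    rw [pow_succ, ih, xv, mono_mul, ← Pi.single_add]; push_cast; rfl

/-- string formula, as an existence statement for dominant-side monomials -/
theorem string_exists {N : ℕ} {a b : Fin N} (h : a ≠ b) (n : ℕ) (γ : Fin N → ℤ)
    (hγ : γ a = γ b + n) :
    (xv a - xv b) * ∑ k ∈ Finset.range (n + 1),
      mono (γ - Pi.single a (k : ℤ) + Pi.single b (k : ℤ)) =
      xv a * mono γ - xv b * sw a b (mono γ) := by
  have h1 : sw a b (mono γ) = mono (γ - Pi.single a (n : ℤ) + Pi.single b (n : ℤ)) := by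
    rw [act_mono]
    congr 1
    ext j
    by_cases hja : j = a
    · subst hja; simp [h, hγ]
    · by_cases hjb : j = b
      · subst hjb; simp [hja, hγ]
      · simp [hja, hjb, Equiv.swap_apply_of_ne_of_ne hja hjb]
  rw [h1, sub_mul, Finset.mul_sum, Finset.mul_sum]
  rw [Finset.sum_range_succ', Finset.sum_range_succ (f := fun k => xv b * _)]
  have h2 : ∀ k ∈ Finset.range n,
      xv a * mono (γ - Pi.single a ((k + 1 : ℕ) : ℤ) + Pi.single b ((k + 1 : ℕ) : ℤ)) =
      xv b * mono (γ - Pi.single a (k : ℤ) + Pi.single b (k : ℤ)) := by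
    intro k _
    rw [xv, xv, mono_mul, mono_mul]
    congr 1
    push_cast
    rw [Pi.single_add, Pi.single_add]
    abel
  rw [Finset.sum_congr rfl h2]
  simp

theorem pi_exists {N : ℕ} (a b : Fin N) (f : LR N) :
    ∃ g, (xv a - xv b) * g = xv a * f - xv b * sw a b f := by
  by_cases h : a = b
  · subst h; exact ⟨0, by
      have : sw a a f = f := by
        rw [sw, Equiv.swap_self]; exact act_one f
      rw [this]; simp⟩
  revert f
  apply LR_ind
  · exact ⟨0, by simp⟩
  · rintro f g ⟨f', hf⟩ ⟨g', hg⟩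
    exact ⟨f' + g', by rw [map_add]; linear_combination hf + hg⟩
  · rintro f ⟨f', hf⟩
    exact ⟨-f', by rw [map_neg]; linear_combination -hf⟩
  · intro γ
    by_cases hle : γ b ≤ γ a
    · obtain ⟨n, hn⟩ := Int.eq_ofNat_of_zero_le (sub_nonneg.mpr hle)
      exact ⟨_, string_exists h n γ (by omega)⟩
    · obtain ⟨n, hn⟩ := Int.eq_ofNat_of_zero_le (sub_nonneg.mpr (le_of_lt (not_le.mp hle)))
      have := string_exists h n (fun j => γ ((Equiv.swap a b)⁻¹ j)) (by simp; omega)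
      rw [← act_mono] at this
      rw [sw_sw] at this
      obtain ⟨g, hg⟩ : ∃ g, (xv a - xv b) * g = xv a * sw a b (mono γ) - xv b * mono γ := ⟨_, this⟩
      exact ⟨mono γ + sw a b (mono γ) - g, by rw [mul_sub, hg]; ring⟩

noncomputable def demFun {N : ℕ} (a b : Fin N) (f : LR N) : LR N :=
  Classical.choose (pi_exists a b f)

theorem demFun_spec {N : ℕ} (a b : Fin N) (f : LR N) :
    (xv a - xv b) * demFun a b f = xv a * f - xv b * sw a b f :=
  Classical.choose_spec (pi_exists a b f)

/-- The isobaric divided difference operator. -/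
noncomputable def dem {N : ℕ} (a b : Fin N) : LR N →ₗ[ℤ] LR N :=
  if h : a = b then 0 else
  { toFun := demFun a b
    map_add' := fun f g => by
      apply mul_left_cancel₀ (xv_sub_ne h)
      rw [mul_add, demFun_spec, demFun_spec, demFun_spec, map_add]; ring
    map_smul' := fun c f => by
      apply mul_left_cancel₀ (xv_sub_ne h)
      rw [RingHom.id_apply, mul_smul_comm, demFun_spec, demFun_spec, map_zsmul, mul_smul_comm,
        mul_smul_comm, smul_sub] }

theorem dem_spec {N : ℕ} {a b : Fin N} (h : a ≠ b) (f : LR N) :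
    (xv a - xv b) * dem a b f = xv a * f - xv b * sw a b f := by
  rw [dem, dif_neg h]
  exact demFun_spec a b f

theorem dem_unique {N : ℕ} {a b : Fin N} (h : a ≠ b) {f g : LR N}
    (hg : (xv a - xv b) * g = xv a * f - xv b * sw a b f) : dem a b f = g :=
  mul_left_cancel₀ (xv_sub_ne h) (by rw [dem_spec h, hg])

theorem dem_string {N : ℕ} {a b : Fin N} (h : a ≠ b) (n : ℕ) (γ : Fin N → ℤ)
    (hγ : γ a = γ b + n) :
    dem a b (mono γ) = ∑ k ∈ Finset.range (n + 1),
      mono (γ - Pi.single a (k : ℤ) + Pi.single b (k : ℤ)) :=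
  dem_unique h (string_exists h n γ hγ)

theorem sw_dem {N : ℕ} {a b : Fin N} (h : a ≠ b) (f : LR N) :
    sw a b (dem a b f) = dem a b f := by
  apply mul_left_cancel₀ (xv_sub_ne h)
  have := congrArg (sw a b) (dem_spec h f)
  simp only [map_mul, map_sub, sw_left, sw_right, sw_sw] at this
  rw [dem_spec h]
  linear_combination -this

theorem dem_of_sym {N : ℕ} {a b : Fin N} (h : a ≠ b) {f : LR N} (hf : sw a b f = f) :
    dem a b f = f := dem_unique h (by rw [hf]; ring)

theorem dem_mul_sym {N : ℕ} {a b : Fin N} (h : a ≠ b) {f g : LR N} (hg : sw a b g = g) :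
    dem a b (g * f) = g * dem a b f := by
  apply dem_unique h
  rw [map_mul, hg]
  linear_combination g * dem_spec h f

theorem dem_idem {N : ℕ} {a b : Fin N} (h : a ≠ b) (f : LR N) :
    dem a b (dem a b f) = dem a b f := dem_of_sym h (sw_dem h f)

theorem dem_xb {N : ℕ} {a b : Fin N} (h : a ≠ b) {f : LR N} (hf : sw a b f = f) :
    dem a b (xv b * f) = 0 := by
  apply dem_unique h
  rw [map_mul, hf, sw_right]; ring

theorem xa_dem {N : ℕ} {a b : Fin N} (h : a ≠ b) (f : LR N) :
    xv a * dem a b f = dem a b (xv b * f) + xv a * f := by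
  apply mul_left_cancel₀ (xv_sub_ne h)
  have h1 := dem_spec h (xv b * f)
  rw [map_mul (sw a b), sw_right] at h1
  linear_combination xv a * dem_spec h f - h1

theorem dem_add_sw {N : ℕ} {a b : Fin N} (h : a ≠ b) (f : LR N) :
    dem a b (sw a b f) = f + sw a b f - dem a b f := by
  have : dem a b (f + sw a b f) = f + sw a b f := dem_of_sym h (by rw [map_add, sw_sw, add_comm])
  rw [map_add] at this
  linear_combination this

theorem sw_sw_comm {N : ℕ} {a b c d : Fin N} (h1 : a ≠ c) (h2 : a ≠ d) (h3 : b ≠ c) (h4 : b ≠ d)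
    (f : LR N) : sw a b (sw c d f) = sw c d (sw a b f) := by
  have : Equiv.swap a b * Equiv.swap c d = Equiv.swap c d * Equiv.swap a b := by
    ext j
    simp only [Equiv.Perm.mul_apply, Equiv.swap_apply_def]
    split_ifs <;> simp_all
  simp only [sw, act_act, this]

theorem sw_dem_comm {N : ℕ} {a b c d : Fin N} (hcd : c ≠ d)
    (h1 : a ≠ c) (h2 : a ≠ d) (h3 : b ≠ c) (h4 : b ≠ d) (f : LR N) :
    sw a b (dem c d f) = dem c d (sw a b f) := by
  symm
  apply dem_unique hcd
  have := congrArg (sw a b) (dem_spec hcd f)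
  simp only [map_mul, map_sub, sw_of_ne h1.symm h3.symm, sw_of_ne h2.symm h4.symm] at this
  rw [this, sw_sw_comm h1 h2 h3 h4]

theorem dem_comm {N : ℕ} {a b c d : Fin N} (hab : a ≠ b) (hcd : c ≠ d)
    (h1 : a ≠ c) (h2 : a ≠ d) (h3 : b ≠ c) (h4 : b ≠ d) (f : LR N) :
    dem a b (dem c d f) = dem c d (dem a b f) := by
  apply dem_unique hab
  apply mul_left_cancel₀ (xv_sub_ne hcd)
  have e1 := dem_spec hcd (dem a b f)
  have e2 := dem_spec hab f
  have e3 := congrArg (sw c d) e2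
  simp only [map_mul, map_sub, sw_of_ne h1 h2, sw_of_ne h3 h4] at e3
  have e4 := dem_spec hcd f
  have e5 := congrArg (sw a b) e4
  simp only [map_mul, map_sub, sw_of_ne h1.symm h3.symm, sw_of_ne h2.symm h4.symm,
    sw_sw_comm h1 h2 h3 h4] at e5
  linear_combination (xv a - xv b) * e1 + xv c * e2 - xv d * e3 - xv a * e4 + xv b * e5

theorem dem_braid {N : ℕ} {a b c : Fin N} (hab : a ≠ b) (hbc : b ≠ c) (hac : a ≠ c) (f : LR N) :
    dem a b (dem b c (dem a b f)) = dem b c (dem a b (dem b c f)) := by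
  have hw : sw a b (sw b c (sw a b f)) = sw b c (sw a b (sw b c f)) := by
    have : Equiv.swap a b * (Equiv.swap b c * Equiv.swap a b) =
        Equiv.swap b c * (Equiv.swap a b * Equiv.swap b c) := by
      ext j
      simp only [Equiv.Perm.mul_apply, Equiv.swap_apply_def]
      split_ifs <;> simp_all
    simp only [sw, act_act, this]
  apply mul_left_cancel₀ (mul_ne_zero (mul_ne_zero (xv_sub_ne hab) (xv_sub_ne hac)) (xv_sub_ne hbc))
  have sac : sw b c (xv a : LR N) = xv a := sw_of_ne hab hac
  have scab : sw a b (xv c : LR N) = xv c := sw_of_ne hac.symm hbc.symm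
  have p1 := dem_spec hab f
  have p2 := dem_spec hbc (dem a b f)
  have p3 := dem_spec hab (dem b c (dem a b f))
  have p1' := congrArg (sw b c) p1
  have p2' := congrArg (sw a b) p2
  have p1'' := congrArg (sw a b) p1'
  have q1 := dem_spec hbc f
  have q2 := dem_spec hab (dem b c f)
  have q3 := dem_spec hbc (dem a b (dem b c f))
  have q1' := congrArg (sw a b) q1
  have q2' := congrArg (sw b c) q2
  have q1'' := congrArg (sw b c) q1'
  simp only [map_mul, map_sub, sw_left, sw_right, sac, scab, sw_dem hab, sw_dem hbc] at *
  rw [← hw] at q1''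
  linear_combination (xv a - xv c) * (xv b - xv c) * p3 + xv a * (xv a - xv c) * p2
    - xv b * (xv b - xv c) * p2' + xv a * xv b * p1 - xv a * xv c * p1' + xv b * xv c * p1''
    - (xv a - xv b) * (xv a - xv c) * q3 - xv b * (xv a - xv c) * q2 + xv c * (xv a - xv b) * q2'
    - xv a * xv a * q1 + xv b * xv b * q1' - xv c * xv c * q1''

end

section
def adj {N : ℕ} (a b : Fin N) : Prop := (a : ℕ) + 1 = b

theorem adj.ne {N : ℕ} {a b : Fin N} (h : adj a b) : a ≠ b := by
  rintro rfl; simp [adj] at h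

theorem adj.lt {N : ℕ} {a b : Fin N} (h : adj a b) : a < b := by
  rw [Fin.lt_def]; unfold adj at h; omega

theorem exists_ascent {N : ℕ} {α : Fin N → ℤ} (h : ¬ Antitone α) :
    ∃ a b, adj a b ∧ α a < α b := by
  by_contra hc
  push Not at hc
  apply h
  have key : ∀ n : ℕ, ∀ a b : Fin N, (a : ℕ) + n = b → α b ≤ α a := by
    intro n
    induction n with
    | zero => intro a b hab; rw [show a = b from Fin.ext (by simpa using hab)]
    | succ n ih =>
      intro a b hab
      have hb := b.isLt
      have h1 := ih a ⟨a + n, by omega⟩ rfl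
      have h2 := hc ⟨a + n, by omega⟩ b (by unfold adj; simp; omega)
      exact h2.trans h1
  intro a b hab
  exact key (b - a) a b (by rw [Fin.le_def] at hab; omega)

/-- rank-weighted measure -/
def rk {N : ℕ} (α : Fin N → ℤ) (i : Fin N) : ℕ := (Finset.univ.filter (fun j => α j < α i)).card

def msr {N : ℕ} (α : Fin N → ℤ) : ℕ := ∑ i : Fin N, (i : ℕ) * rk α i

theorem rk_swap {N : ℕ} (α : Fin N → ℤ) (σ : Equiv.Perm (Fin N)) (i : Fin N) :
    rk (α ∘ σ) i = rk α (σ i) := by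
  unfold rk
  apply Finset.card_bij (fun j _ => σ j)
  · intro j hj; simpa using hj
  · intro j _ k _ h; exact σ.injective h
  · intro j hj; exact ⟨σ⁻¹ j, by simpa using hj, by simp⟩

theorem rk_lt {N : ℕ} {α : Fin N → ℤ} {a b : Fin N} (h : α a < α b) : rk α a < rk α b := by
  apply Finset.card_lt_card
  rw [Finset.ssubset_iff_of_subset]
  · exact ⟨a, by simpa using h, by simp⟩
  · intro j hj; simp at hj ⊢; omega

theorem msr_lt {N : ℕ} {α : Fin N → ℤ} {a b : Fin N} (hab : adj a b) (h : α a < α b) :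
    msr (α ∘ Equiv.swap a b) < msr α := by
  unfold msr
  simp only [rk_swap]
  have hne := hab.ne
  rw [← Finset.add_sum_erase _ _ (Finset.mem_univ a),
    ← Finset.add_sum_erase (a := b) (Finset.univ.erase a) _ (by simp [hne.symm]),
    ← Finset.add_sum_erase _ (fun i : Fin N => (i : ℕ) * rk α i) (Finset.mem_univ a),
    ← Finset.add_sum_erase (a := b) (Finset.univ.erase a) (fun i : Fin N => (i : ℕ) * rk α i)
      (by simp [hne.symm])]
  have : ∑ x ∈ (Finset.univ.erase a).erase b, (x : ℕ) * rk α (Equiv.swap a b x) =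
      ∑ x ∈ (Finset.univ.erase a).erase b, (x : ℕ) * rk α x := by
    apply Finset.sum_congr rfl
    intro x hx
    simp at hx
    rw [Equiv.swap_apply_of_ne_of_ne hx.2 hx.1]
  rw [this]
  simp only [Equiv.swap_apply_left, Equiv.swap_apply_right]
  have h2 := rk_lt h
  unfold adj at hab
  nlinarith

open Classical in
noncomputable def key {N : ℕ} {M : Type*} (T : Fin N → Fin N → M → M) (F : (Fin N → ℤ) → M)
    (α : Fin N → ℤ) : M :=
  if h : Antitone α then F α else
    T (exists_ascent h).choose (exists_ascent h).choose_spec.choose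
      (key T F (α ∘ Equiv.swap (exists_ascent h).choose (exists_ascent h).choose_spec.choose))
termination_by msr α
decreasing_by
  exact msr_lt (exists_ascent h).choose_spec.choose_spec.1 (exists_ascent h).choose_spec.choose_spec.2

theorem key_dom {N : ℕ} {M : Type*} (T : Fin N → Fin N → M → M) (F : (Fin N → ℤ) → M)
    {α : Fin N → ℤ} (h : Antitone α) : key T F α = F α := by
  rw [key, dif_pos h]

theorem key_asc {N : ℕ} {M : Type*} (T : Fin N → Fin N → M → M) (F : (Fin N → ℤ) → M)
    {α : Fin N → ℤ} (h : ¬ Antitone α) :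
    ∃ a b, adj a b ∧ α a < α b ∧ key T F α = T a b (key T F (α ∘ Equiv.swap a b)) :=
  ⟨_, _, (exists_ascent h).choose_spec.choose_spec.1, (exists_ascent h).choose_spec.choose_spec.2, by
    rw [key, dif_neg h]⟩

theorem key_closed {N : ℕ} {M : Type*} (T : Fin N → Fin N → M → M) (F : (Fin N → ℤ) → M)
    (Q : M → Prop) (hF : ∀ ν, Antitone ν → Q (F ν)) (hT : ∀ a b m, adj a b → Q m → Q (T a b m))
    (α : Fin N → ℤ) : Q (key T F α) := by
  induction hn : msr α using Nat.strong_induction_on generalizing α with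
  | _ n ih =>
    by_cases h : Antitone α
    · rw [key_dom T F h]; exact hF α h
    · obtain ⟨a, b, hab, hlt, he⟩ := key_asc T F h
      rw [he]
      exact hT a b _ hab (ih _ (hn ▸ msr_lt hab hlt) _ rfl)

section
variable {N : ℕ} {M : Type*} (T : Fin N → Fin N → M → M) (F : (Fin N → ℤ) → M)

theorem swap_comp_far {α : Fin N → ℤ} {a b c d : Fin N} (h1 : a ≠ c) (h2 : a ≠ d) (h3 : b ≠ c)
    (h4 : b ≠ d) : (α ∘ Equiv.swap a b) ∘ Equiv.swap c d = (α ∘ Equiv.swap c d) ∘ Equiv.swap a b := by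
  ext j
  simp only [Function.comp, Equiv.swap_apply_def]
  split_ifs <;> simp_all

theorem swap_comp_braid {α : Fin N → ℤ} {a b c : Fin N} (h1 : a ≠ b) (h2 : a ≠ c) (h3 : b ≠ c) :
    ((α ∘ Equiv.swap a b) ∘ Equiv.swap b c) ∘ Equiv.swap a b =
    ((α ∘ Equiv.swap b c) ∘ Equiv.swap a b) ∘ Equiv.swap b c := by
  ext j
  simp only [Function.comp, Equiv.swap_apply_def]
  split_ifs <;> simp_all

theorem key_main
    (hcomm : ∀ a b c d m, adj a b → adj c d → a ≠ c → a ≠ d → b ≠ c → b ≠ d →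
      T a b (T c d m) = T c d (T a b m))
    (hbraid : ∀ a b c m, adj a b → adj b c →
      T a b (T b c (T a b m)) = T b c (T a b (T b c m)))
    (hF : ∀ a b ν, adj a b → Antitone ν → ν a = ν b → T a b (F ν) = F ν)
    (α : Fin N → ℤ) :
    (∀ a b, adj a b → α a < α b → key T F α = T a b (key T F (α ∘ Equiv.swap a b))) ∧
    (∀ a b, adj a b → α a = α b → T a b (key T F α) = key T F α) := by
  induction hn : msr α using Nat.strong_induction_on generalizing α with
  | _ n ih =>
    subst hn
    by_cases h : Antitone α
    · refine ⟨fun a b hab hlt => absurd (h hab.lt.le) (not_le.mpr hlt), fun a b hab he => ?_⟩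
      rw [key_dom T F h]; exact hF a b α hab h he
    obtain ⟨a, b, hab, hlt, he⟩ := key_asc T F h
    have IH : ∀ β, msr β < msr α → _ := fun β hβ => ih _ hβ β rfl
    have m1 := msr_lt hab hlt
    constructor
    · intro c d hcd hlt2
      have m2 := msr_lt hcd hlt2
      by_cases hac : a = c
      · subst hac
        have : b = d := Fin.ext (by unfold adj at hab hcd; omega)
        subst this; exact he
      by_cases hbc : b = c
      · subst hbc
        have had : a ≠ d := by rintro rfl; unfold adj at hab hcd; omega
        have nab := hab.ne
        have nbd := hcd.ne
        -- s_ab α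
        have e1 := (IH _ m1).1 b d hcd (by
          simp [Equiv.swap_apply_of_ne_of_ne had.symm nbd.symm]; omega)
        have m3 := msr_lt (α := α ∘ Equiv.swap a b) hcd (by
          simp [Equiv.swap_apply_of_ne_of_ne had.symm nbd.symm]; omega)
        have e2 := (IH _ (m3.trans m1)).1 a b hab (by
          simp [Equiv.swap_apply_of_ne_of_ne had.symm nbd.symm, Equiv.swap_apply_of_ne_of_ne nab had]; omega)
        have f1 := (IH _ m2).1 a b hab (by
          simp [Equiv.swap_apply_of_ne_of_ne nab had]; omega)
        have m4 := msr_lt (α := α ∘ Equiv.swap b d) hab (by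
          simp [Equiv.swap_apply_of_ne_of_ne nab had]; omega)
        have f2 := (IH _ (m4.trans m2)).1 b d hcd (by
          simp [Equiv.swap_apply_of_ne_of_ne had.symm nbd.symm, Equiv.swap_apply_of_ne_of_ne nab had]; omega)
        rw [he, e1, e2, f1, f2, swap_comp_braid nab had nbd]
        exact hbraid _ _ _ _ hab hcd
      by_cases had : a = d
      · subst had
        have hcb : c ≠ b := fun h => hbc h.symm
        have nab := hab.ne
        have nca := hcd.ne
        have e1 := (IH _ m1).1 c a hcd (by
          simp [Equiv.swap_apply_of_ne_of_ne nca hcb]; omega)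
        have m3 := msr_lt (α := α ∘ Equiv.swap a b) hcd (by
          simp [Equiv.swap_apply_of_ne_of_ne nca hcb]; omega)
        have e2 := (IH _ (m3.trans m1)).1 a b hab (by
          simp [Equiv.swap_apply_of_ne_of_ne nca hcb, Equiv.swap_apply_of_ne_of_ne hcb.symm nab.symm]; omega)
        have f1 := (IH _ m2).1 a b hab (by
          simp [Equiv.swap_apply_of_ne_of_ne hcb.symm nab.symm]; omega)
        have m4 := msr_lt (α := α ∘ Equiv.swap c a) hab (by
          simp [Equiv.swap_apply_of_ne_of_ne hcb.symm nab.symm]; omega)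
        have f2 := (IH _ (m4.trans m2)).1 c a hcd (by
          simp [Equiv.swap_apply_of_ne_of_ne nca hcb, Equiv.swap_apply_of_ne_of_ne hcb.symm nab.symm]; omega)
        rw [he, e1, e2, f1, f2, swap_comp_braid nca hcb nab]
        exact (hbraid _ _ _ _ hcd hab).symm
      have hbd : b ≠ d := by
        rintro rfl; apply hac; exact Fin.ext (by unfold adj at hab hcd; omega)
      have e1 := (IH _ m1).1 c d hcd (by
          simp [Equiv.swap_apply_of_ne_of_ne (Ne.symm hac) (Ne.symm hbc),
            Equiv.swap_apply_of_ne_of_ne (Ne.symm had) (Ne.symm hbd)]; omega)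
      have f1 := (IH _ m2).1 a b hab (by
          simp [Equiv.swap_apply_of_ne_of_ne hac had,
            Equiv.swap_apply_of_ne_of_ne hbc hbd]; omega)
      rw [he, e1, f1, swap_comp_far hac had hbc hbd]
      exact hcomm _ _ _ _ _ hab hcd hac had hbc hbd
    · intro c d hcd heq
      by_cases hac : a = c
      · subst hac
        have : b = d := Fin.ext (by unfold adj at hab hcd; omega)
        subst this; omega
      by_cases hbc : b = c
      · -- a < b = d values : x y y
        subst hbc
        have had : a ≠ d := by rintro rfl; unfold adj at hab hcd; omega
        have nab := hab.ne
        have nbd := hcd.ne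
        have e1 := (IH _ m1).1 b d hcd (by
          simp [Equiv.swap_apply_of_ne_of_ne had.symm nbd.symm]; omega)
        have m3 := msr_lt (α := α ∘ Equiv.swap a b) hcd (by
          simp [Equiv.swap_apply_of_ne_of_ne had.symm nbd.symm]; omega)
        have e2 := (IH _ (m3.trans m1)).2 a b hab (by
          simp [Equiv.swap_apply_of_ne_of_ne had.symm nbd.symm, Equiv.swap_apply_of_ne_of_ne nab had]; omega)
        rw [he, e1, ← hbraid _ _ _ _ hab hcd, e2]
      by_cases had : a = d
      · subst had
        have hcb : c ≠ b := fun h => hbc h.symm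
        have nab := hab.ne
        have nca := hcd.ne
        have e1 := (IH _ m1).1 c a hcd (by
          simp [Equiv.swap_apply_of_ne_of_ne nca hcb]; omega)
        have m3 := msr_lt (α := α ∘ Equiv.swap a b) hcd (by
          simp [Equiv.swap_apply_of_ne_of_ne nca hcb]; omega)
        have e2 := (IH _ (m3.trans m1)).2 a b hab (by
          simp [Equiv.swap_apply_of_ne_of_ne nca hcb, Equiv.swap_apply_of_ne_of_ne hcb.symm nab.symm]; omega)
        rw [he, e1, hbraid _ _ _ _ hcd hab, e2]
      have hbd : b ≠ d := by
        rintro rfl; apply hac; exact Fin.ext (by unfold adj at hab hcd; omega)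
      have e1 := (IH _ m1).2 c d hcd (by
          simp [Equiv.swap_apply_of_ne_of_ne (Ne.symm hac) (Ne.symm hbc),
            Equiv.swap_apply_of_ne_of_ne (Ne.symm had) (Ne.symm hbd)]; omega)
      rw [he, ← hcomm _ _ _ _ _ hab hcd hac had hbc hbd, e1]

end

end

section
/-- Demazure words applied to dominant monomials satisfying `P`. -/
inductive Wd {N : ℕ} (P : (Fin N → ℤ) → Prop) : LR N → Prop
  | base (ν : Fin N → ℤ) (hν : Antitone ν) (hP : P ν) : Wd P (mono ν)
  | step (a b : Fin N) (hab : adj a b) (f : LR N) (hf : Wd P f) : Wd P (dem a b f)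

/-- The cone spanned by the words. -/
noncomputable def Cn {N : ℕ} (P : (Fin N → ℤ) → Prop) : AddSubmonoid (LR N) := AddSubmonoid.closure {f | Wd P f}

def PT {N : ℕ} : (Fin N → ℤ) → Prop := fun _ => True
def PN {N : ℕ} : (Fin N → ℤ) → Prop := fun ν => ∀ i, 0 ≤ ν i

theorem Wd.mem {N : ℕ} {P : (Fin N → ℤ) → Prop} {f : LR N} (h : Wd P f) : f ∈ Cn P :=
  AddSubmonoid.subset_closure h

/-- A linear map sending words into the cone sends the cone into the cone. -/
theorem Cn_map {N : ℕ} {P Q : (Fin N → ℤ) → Prop} (A : LR N →ₗ[ℤ] LR N)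
    (h : ∀ f, Wd P f → A f ∈ Cn Q) {f : LR N} (hf : f ∈ Cn P) : A f ∈ Cn Q := by
  induction hf using AddSubmonoid.closure_induction with
  | mem x hx => exact h x hx
  | zero => rw [map_zero]; exact AddSubmonoid.zero_mem _
  | add x y _ _ hx hy => rw [map_add]; exact AddSubmonoid.add_mem _ hx hy

theorem Cn_dem {N : ℕ} {P : (Fin N → ℤ) → Prop} {a b : Fin N} (hab : adj a b) {f : LR N}
    (hf : f ∈ Cn P) : dem a b f ∈ Cn P :=
  Cn_map (dem a b) (fun f hf => (Wd.step a b hab f hf).mem) hf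

/-- multiplication by a fixed element as a linear map -/
noncomputable def mulL {N : ℕ} (g : LR N) : LR N →ₗ[ℤ] LR N := LinearMap.mulLeft ℤ g

theorem mulL_apply {N : ℕ} (g f : LR N) : mulL g f = g * f := rfl

theorem sw_mono_eq {N : ℕ} {a b : Fin N} {ν : Fin N → ℤ} (h : ν a = ν b) :
    sw a b (mono ν) = mono ν := by
  rw [act_mono]; congr 1; ext j
  simp only [Equiv.swap_inv, Equiv.swap_apply_def]
  split_ifs <;> simp_all

open Classical in
/-- The operators `Π_v`. -/
noncomputable def Pw {N : ℕ} (v : Fin N → ℤ) : Module.End ℤ (LR N) :=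
  key (M := Module.End ℤ (LR N)) (fun a b O => O * dem a b)
    (fun v => if Function.Injective v then 1 else 0) v

theorem Pw_asc {N : ℕ} (v : Fin N → ℤ) {a b : Fin N} (hab : adj a b) (h : v a < v b) :
    Pw v = Pw (v ∘ Equiv.swap a b) * dem a b := by
  classical
  refine (key_main (M := Module.End ℤ (LR N)) (fun a b O => O * dem a b)
    (fun v => if Function.Injective v then 1 else 0) ?_ ?_ ?_ v).1 a b hab h
  · intro a b c d m hab hcd h1 h2 h3 h4
    refine LinearMap.ext fun f => ?_
    simp only [Module.End.mul_apply]
    rw [dem_comm hab.ne hcd.ne h1 h2 h3 h4]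
  · intro a b c m hab hbc
    have hac : a ≠ c := by rintro rfl; unfold adj at *; omega
    refine LinearMap.ext fun f => ?_
    simp only [Module.End.mul_apply]
    rw [dem_braid hab.ne hbc.ne hac]
  · intro a b ν hab _ he
    rw [if_neg (fun hi => hab.ne (hi he)), zero_mul]

theorem Pw_dom {N : ℕ} {v : Fin N → ℤ} (h : Antitone v) (hi : Function.Injective v) :
    Pw v = 1 := by
  classical
  unfold Pw
  rw [key_dom _ _ h, if_pos hi]

theorem Pw_dem_asc {N : ℕ} (v : Fin N → ℤ) {a b : Fin N} (hab : adj a b) (h : v a < v b)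
    (f : LR N) : Pw v (dem a b f) = Pw v f := by
  rw [Pw_asc v hab h, Module.End.mul_apply, Module.End.mul_apply, dem_idem hab.ne]

theorem swap_swap_comp {N : ℕ} (v : Fin N → ℤ) (a b : Fin N) :
    (v ∘ Equiv.swap a b) ∘ Equiv.swap a b = v := by
  ext j; simp

theorem Pw_dem_desc {N : ℕ} (v : Fin N → ℤ) {a b : Fin N} (hab : adj a b) (h : v b < v a)
    (f : LR N) : Pw v (dem a b f) = Pw (v ∘ Equiv.swap a b) f := by
  rw [Pw_asc (v ∘ Equiv.swap a b) hab (by simpa using h), Module.End.mul_apply, swap_swap_comp]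

theorem Pw_mem {N : ℕ} {P : (Fin N → ℤ) → Prop} (v : Fin N → ℤ) :
    ∀ f, f ∈ Cn P → Pw v f ∈ Cn P := by
  classical
  unfold Pw
  apply key_closed (M := Module.End ℤ (LR N)) _ _ (fun O => ∀ f, f ∈ Cn P → O f ∈ Cn P)
  · intro ν _ f hf
    by_cases hi : Function.Injective ν
    · rw [if_pos hi]; exact hf
    · rw [if_neg hi]; exact AddSubmonoid.zero_mem _
  · intro a b m hab hm f hf
    exact hm _ (Cn_dem hab hf)

/-- indicator vector -/
def ind {N : ℕ} (S : Finset (Fin N)) : Fin N → ℤ := fun i => if i ∈ S then 1 else 0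

def good {N : ℕ} (v : Fin N → ℤ) (S : Finset (Fin N)) : Prop :=
  ∀ a b, a < b → a ∉ S → b ∈ S → v a < v b

theorem adj_lt_left {N : ℕ} {i j a : Fin N} (hij : adj i j) (h : a < j) (h' : a ≠ i) : a < i := by
  unfold adj at hij; rw [Fin.lt_def] at *
  have : (a : ℕ) ≠ i := fun h => h' (Fin.ext h)
  omega

theorem adj_lt_right {N : ℕ} {i j a : Fin N} (hij : adj i j) (h : i < a) (h' : a ≠ j) : j < a := by
  unfold adj at hij; rw [Fin.lt_def] at *
  have : (a : ℕ) ≠ j := fun h => h' (Fin.ext h)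
  omega

theorem Pw_dem_exists {N : ℕ} (v : Fin N → ℤ) (hv : Function.Injective v) {i j : Fin N}
    (hij : adj i j) : ∃ v' : Fin N → ℤ, Function.Injective v' ∧ v' i < v' j ∧
      (∀ f, Pw v (dem i j f) = Pw v' f) ∧ (v' = v ∨ v' = v ∘ Equiv.swap i j) := by
  rcases lt_trichotomy (v i) (v j) with h | h | h
  · exact ⟨v, hv, h, fun f => Pw_dem_asc v hij h f, Or.inl rfl⟩
  · exact absurd (hv h) hij.ne
  · exact ⟨v ∘ Equiv.swap i j, hv.comp (Equiv.swap i j).injective, by simpa using h,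
      fun f => Pw_dem_desc v hij h f, Or.inr rfl⟩

theorem good_case_a {N : ℕ} {v : Fin N → ℤ} {S : Finset (Fin N)} (hg : good v S) {i j : Fin N}
    (hij : adj i j) (hS : i ∈ S ↔ j ∈ S) : good (v ∘ Equiv.swap i j) S := by
  intro a b hlt ha hb
  have hne := hij.ne
  by_cases hai : a = i
  · subst hai
    have hbj : b ≠ j := by rintro rfl; exact ha (hS.mpr hb)
    rw [Function.comp, Function.comp, Equiv.swap_apply_left,
      Equiv.swap_apply_of_ne_of_ne hlt.ne' hbj]
    exact hg _ _ (adj_lt_right hij hlt hbj) (fun h => ha (hS.mpr h)) hb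
  by_cases haj : a = j
  · subst haj
    have hbi : b ≠ i := by rintro rfl; exact ha (hS.mp hb)
    rw [Function.comp, Function.comp, Equiv.swap_apply_right,
      Equiv.swap_apply_of_ne_of_ne hbi hlt.ne']
    exact hg _ _ (hij.lt.trans hlt) (fun h => ha (hS.mp h)) hb
  by_cases hbi : b = i
  · subst hbi
    rw [Function.comp, Function.comp, Equiv.swap_apply_left,
      Equiv.swap_apply_of_ne_of_ne hai haj]
    exact hg _ _ (hlt.trans hij.lt) ha (hS.mp hb)
  by_cases hbj : b = j
  · subst hbj
    rw [Function.comp, Function.comp, Equiv.swap_apply_right,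
      Equiv.swap_apply_of_ne_of_ne hai haj]
    exact hg _ _ (adj_lt_left hij hlt hai) ha (hS.mpr hb)
  rw [Function.comp, Function.comp, Equiv.swap_apply_of_ne_of_ne hai haj,
    Equiv.swap_apply_of_ne_of_ne hbi hbj]
  exact hg _ _ hlt ha hb

theorem good_case_b {N : ℕ} {v v' : Fin N → ℤ} {S : Finset (Fin N)} (hg : good v S) {i j : Fin N}
    (hij : adj i j) (hi : i ∈ S) (hj : j ∉ S) (h' : v' i < v' j)
    (hv' : v' = v ∨ v' = v ∘ Equiv.swap i j) : good v' (insert j (S.erase i)) := by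
  intro a b hlt ha hb
  have hne := hij.ne
  simp only [Finset.mem_insert, Finset.mem_erase, not_or, not_and] at ha hb
  have ho : ∀ x, x ≠ i → x ≠ j → v' x = v x := by
    intro x hxi hxj
    rcases hv' with rfl | rfl
    · rfl
    · simp [Equiv.swap_apply_of_ne_of_ne hxi hxj]
  have hvi : v' i ≤ v j ∧ v i ≤ v' j ∨ v' i ≤ v i ∧ v' i ≤ v j ∧ v i ≤ v' j := by
    rcases hv' with rfl | rfl
    · right; exact ⟨le_rfl, h'.le, h'.le⟩
    · left; simp
  by_cases hai : a = i
  · subst hai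
    by_cases hbj : b = j
    · subst hbj; exact h'
    · have := hg j b (adj_lt_right hij hlt hbj) hj (by tauto)
      rw [ho b hlt.ne' hbj]; omega
  · have haj : a ≠ j := ha.1
    have haS : a ∉ S := ha.2 hai
    by_cases hbj : b = j
    · subst hbj
      have := hg a i (adj_lt_left hij hlt hai) haS hi
      rw [ho a hai haj]; omega
    · have hbi : b ≠ i := by tauto
      rw [ho a hai haj, ho b hbi hbj]
      exact hg a b hlt haS (by tauto)

theorem ind_split {N : ℕ} {S : Finset (Fin N)} {i : Fin N} (hi : i ∈ S) :
    (mono (ind S) : LR N) = xv i * mono (ind (S.erase i)) := by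
  rw [xv, mono_mul]; congr 1; ext k
  simp only [ind, Pi.add_apply, Pi.single_apply, Finset.mem_erase]
  split_ifs <;> simp_all

theorem mult_ind_aux {N : ℕ} {f : LR N} (hf : Wd PT f) :
    ∀ (v : Fin N → ℤ) (S : Finset (Fin N)), Function.Injective v → good v S →
      Pw v (mono (ind S) * f) ∈ Cn (PT (N := N)) := by
  induction hf with
  | base ν hν _ =>
    intro v S hv hg
    rw [mono_mul]
    by_cases hA : Antitone (ind S + ν)
    · exact Pw_mem v _ (Wd.base _ hA trivial).mem
    · obtain ⟨i, j, hij, hlt⟩ := exists_ascent hA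
      have h1 := hν hij.lt.le
      simp only [Pi.add_apply, ind] at hlt
      have hjS : j ∈ S := by
        by_contra h; rw [if_neg h] at hlt; split_ifs at hlt <;> omega
      have hiS : i ∉ S := by
        intro h; rw [if_pos h, if_pos hjS] at hlt; omega
      rw [if_pos hjS, if_neg hiS] at hlt
      rw [← Pw_dem_asc v hij (hg i j hij.lt hiS hjS), ← mono_mul, ind_split hjS, mul_assoc,
        mono_mul, dem_xb hij.ne, map_zero]
      · exact AddSubmonoid.zero_mem _
      · apply sw_mono_eq
        simp [ind, hiS]; omega
  | step i j hij f hf ih =>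
    intro v S hv hg
    have hne := hij.ne
    obtain ⟨v', hv'i, hv'l, hPv', hv'o⟩ := Pw_dem_exists v hv hij
    by_cases hiS : i ∈ S
    · by_cases hjS : j ∈ S
      · rw [← dem_mul_sym hne (sw_mono_eq (by simp [ind, hiS, hjS])), hPv']
        apply ih _ _ hv'i
        rcases hv'o with rfl | rfl
        · exact hg
        · exact good_case_a hg hij (by simp [hiS, hjS])
      · have hsym : sw i j (mono (ind (S.erase i)) : LR N) = mono (ind (S.erase i)) :=
          sw_mono_eq (by simp [ind, hjS])
        have e : mono (ind S) * dem i j f = dem i j (mono (ind (insert j (S.erase i))) * f)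
            + mono (ind S) * f := by
          rw [ind_split hiS, ind_split (S := insert j (S.erase i)) (Finset.mem_insert_self _ _),
            Finset.erase_insert (by simp [hjS]), mul_comm (xv i), mul_assoc, xa_dem hne, mul_add,
            ← dem_mul_sym hne hsym]
          congr 1
          · congr 1; ring
          · ring
        rw [e, map_add, hPv']
        exact AddSubmonoid.add_mem _ (ih _ _ hv'i (good_case_b hg hij hiS hjS hv'l hv'o))
          (ih _ _ hv hg)
    · by_cases hjS : j ∈ S
      · rw [← Pw_dem_asc v hij (hg i j hij.lt hiS hjS), ind_split hjS]
        have hsym : sw i j (mono (ind (S.erase j)) : LR N) = mono (ind (S.erase j)) :=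
          sw_mono_eq (by simp [ind, hiS])
        rw [mul_assoc, dem_xb hne, map_zero]
        · exact AddSubmonoid.zero_mem _
        · rw [map_mul (sw i j), hsym, sw_dem hne]
      · rw [← dem_mul_sym hne (sw_mono_eq (by simp [ind, hiS, hjS])), hPv']
        apply ih _ _ hv'i
        rcases hv'o with rfl | rfl
        · exact hg
        · exact good_case_a hg hij (by simp [hiS, hjS])

theorem mult_ind {N : ℕ} {f : LR N} (hf : f ∈ Cn (PT (N := N))) (S : Finset (Fin N))
    (hS : ∀ a b, a < b → b ∈ S → a ∈ S) : mono (ind S) * f ∈ Cn (PT (N := N)) := by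
  refine Cn_map (mulL (mono (ind S))) ?_ hf
  intro f hf
  have hi : Function.Injective (fun i : Fin N => -((i : ℕ) : ℤ)) := by
    intro a b h; exact Fin.ext (by simpa using h)
  have := mult_ind_aux hf (fun i => -((i : ℕ) : ℤ)) S hi
    (fun a b hab ha hb => absurd (hS a b hab hb) ha)
  rwa [Pw_dom (by intro a b hab; simpa using hab) hi] at this

theorem mult_const {N : ℕ} {P : (Fin N → ℤ) → Prop} (c : ℤ)
    {f : LR N} (hf : Wd P f) : mono (fun _ => c) * f ∈ Cn (PT (N := N)) := by
  induction hf with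
  | base ν hν _ =>
    rw [mono_mul]
    exact (Wd.base _ (fun a b h => by simpa using hν h) trivial).mem
  | step i j hij f hf ih =>
    rw [← dem_mul_sym hij.ne (sw_mono_eq rfl)]
    exact Cn_dem hij ih

theorem mult_dom_nonneg {N : ℕ} (n : ℕ) : ∀ (ν : Fin N → ℤ), Antitone ν → (∀ i, 0 ≤ ν i) →
    (∀ i, ν i ≤ n) → ∀ f ∈ Cn (PT (N := N)), mono ν * f ∈ Cn (PT (N := N)) := by
  induction n with
  | zero =>
    intro ν _ h0 h1 f hf
    have : ν = 0 := by ext i; have := h0 i; have := h1 i; simp at *; omega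
    rw [this, mono_zero, one_mul]; exact hf
  | succ n ih =>
    intro ν hν h0 h1 f hf
    let S : Finset (Fin N) := Finset.univ.filter (fun i => ν i = n + 1)
    have e : ν = ind S + (ν - ind S) := by ring
    rw [e, ← mono_mul, mul_assoc]
    have hmem : ∀ i, i ∈ S ↔ ν i = n + 1 := by intro i; simp [S]
    apply mult_ind _ S
    · intro a b hab hb
      rw [hmem] at *
      have := hν hab.le; have := h1 a; push_cast at *; omega
    · apply ih _ _ _ _ f hf
      · intro a b hab
        have h2 := hν hab; have h3 := h1 a; have h4 := h1 b
        simp only [Pi.sub_apply, ind, hmem]; push_cast at *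
        split_ifs <;> omega
      · intro i; have h2 := h0 i
        simp only [Pi.sub_apply, ind, hmem]; push_cast at *
        split_ifs <;> omega
      · intro i; have h2 := h1 i
        simp only [Pi.sub_apply, ind, hmem]; push_cast at *
        split_ifs <;> omega

theorem mult_dom {N : ℕ} {ν : Fin N → ℤ} (hν : Antitone ν) {f : LR N}
    (hf : f ∈ Cn (PT (N := N))) : mono ν * f ∈ Cn (PT (N := N)) := by
  obtain ⟨B, hB⟩ : ∃ B : ℕ, ∀ i, |ν i| ≤ B := by
    refine ⟨∑ i, (ν i).natAbs, fun i => ?_⟩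
    rw [Int.abs_eq_natAbs]
    exact_mod_cast Finset.single_le_sum (f := fun i => (ν i).natAbs) (fun _ _ => Nat.zero_le _)
      (Finset.mem_univ i)
  have e : ν = (fun _ => -(B : ℤ)) + (ν + fun _ => (B : ℤ)) := by ext i; simp
  rw [e, ← mono_mul, mul_assoc]
  refine Cn_map (P := PT) (mulL (mono (fun _ => -(B : ℤ)))) (fun g hg => mult_const _ hg) ?_
  apply mult_dom_nonneg (2 * B) _ _ _ _ f hf
  · intro a b h; simpa using hν h
  · intro i; have := abs_le.mp (hB i); simp; omega
  · intro i; have := abs_le.mp (hB i); simp; omega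

end

section
theorem self_add_zero {N : ℕ} {f : LR N} (h : f + f = 0) : f = 0 := by
  ext γ
  have := congrArg (fun g : LR N => g.coeff γ) h
  simp at this ⊢
  omega

theorem add_self_inj {N : ℕ} {f g : LR N} (h : f + f = g + g) : f = g := by
  rw [← sub_eq_zero]; apply self_add_zero
  linear_combination h

/-- antisymmetrizer -/
noncomputable def J {N : ℕ} : LR N →ₗ[ℤ] LR N where
  toFun f := ∑ σ : Equiv.Perm (Fin N), (Equiv.Perm.sign σ : ℤ) • act σ f
  map_add' f g := by simp [smul_add, Finset.sum_add_distrib]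
  map_smul' c f := by
    simp only [map_zsmul, RingHom.id_apply, Finset.smul_sum]
    exact Finset.sum_congr rfl fun σ _ => smul_comm _ _ _

theorem J_apply {N : ℕ} (f : LR N) :
    J f = ∑ σ : Equiv.Perm (Fin N), (Equiv.Perm.sign σ : ℤ) • act σ f := rfl

theorem J_act {N : ℕ} (τ : Equiv.Perm (Fin N)) (f : LR N) :
    J (act τ f) = (Equiv.Perm.sign τ : ℤ) • J f := by
  rw [J_apply, J_apply, Finset.smul_sum]
  apply Fintype.sum_equiv (Equiv.mulRight τ)
  intro σ
  rw [act_act, Equiv.coe_mulRight, Equiv.Perm.sign_mul, smul_smul]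
  congr 1
  rcases Int.units_eq_one_or (Equiv.Perm.sign τ) with h | h <;> simp [h]

theorem act_J {N : ℕ} (τ : Equiv.Perm (Fin N)) (f : LR N) :
    act τ (J f) = (Equiv.Perm.sign τ : ℤ) • J f := by
  rw [J_apply, Finset.smul_sum, map_sum]
  apply Fintype.sum_equiv (Equiv.mulLeft τ)
  intro σ
  rw [map_zsmul, act_act, Equiv.coe_mulLeft, Equiv.Perm.sign_mul, smul_smul]
  congr 1
  rcases Int.units_eq_one_or (Equiv.Perm.sign τ) with h | h <;> simp [h]

theorem J_sw {N : ℕ} {a b : Fin N} (h : a ≠ b) (f : LR N) : J (sw a b f) = - J f := by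
  rw [J_act, Equiv.Perm.sign_swap h]; simp

theorem sw_J {N : ℕ} {a b : Fin N} (h : a ≠ b) (f : LR N) : sw a b (J f) = - J f := by
  rw [act_J, Equiv.Perm.sign_swap h]; simp

def dl {N : ℕ} : Fin N → ℤ := fun i => -(((i : ℕ) : ℤ) + 1)

theorem J_dem {N : ℕ} {a b : Fin N} (hab : adj a b) (f : LR N) :
    J (mono dl * dem a b f) = J (mono dl * f) := by
  have hne := hab.ne
  obtain ⟨m, hm, hs⟩ : ∃ m : LR N, mono dl = xv a * m ∧ sw a b m = m := by
    refine ⟨mono (dl - Pi.single a 1), ?_, ?_⟩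
    · rw [xv, mono_mul]; congr 1; abel
    · apply sw_mono_eq
      unfold adj at hab
      simp [dl, hne.symm]; omega
  have e1 : (xv a * m * dem a b f) - sw a b (xv a * m * dem a b f) =
      xv a * m * f - sw a b (xv a * m * f) := by
    simp only [map_mul (sw a b), sw_left, hs, sw_dem hne]
    linear_combination m * dem_spec hne f
  have e2 := congrArg J e1
  rw [map_sub, map_sub, J_sw hne, J_sw hne] at e2
  rw [hm]
  apply add_self_inj
  linear_combination e2

noncomputable def kp {N : ℕ} (α : Fin N → ℤ) : LR N := key (fun a b f => dem a b f) mono α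

theorem kp_main {N : ℕ} (α : Fin N → ℤ) :
    (∀ a b, adj a b → α a < α b → kp α = dem a b (kp (α ∘ Equiv.swap a b))) ∧
    (∀ a b, adj a b → α a = α b → dem a b (kp α) = kp α) := by
  refine key_main (fun a b f => dem a b f) mono ?_ ?_ ?_ α
  · intro a b c d m hab hcd h1 h2 h3 h4
    exact dem_comm hab.ne hcd.ne h1 h2 h3 h4 m
  · intro a b c m hab hbc
    have hac : a ≠ c := by rintro rfl; unfold adj at *; omega
    exact dem_braid hab.ne hbc.ne hac m
  · intro a b ν hab _ he
    exact dem_of_sym hab.ne (sw_mono_eq he)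

theorem J_kp {N : ℕ} (α : Fin N → ℤ) : ∀ σ : Equiv.Perm (Fin N), Antitone (α ∘ σ) →
    J (mono dl * kp α) = J (mono dl * mono (α ∘ σ)) := by
  induction hn : msr α using Nat.strong_induction_on generalizing α with
  | _ n ih =>
    subst hn
    intro σ hσ
    by_cases h : Antitone α
    · have : α ∘ σ = α ∘ (1 : Equiv.Perm (Fin N)) := Tuple.unique_antitone hσ h
      rw [this, kp, key_dom _ _ h]; rfl
    · obtain ⟨a, b, hab, hlt⟩ := exists_ascent h
      have e : (α ∘ Equiv.swap a b) ∘ (Equiv.swap a b * σ : Equiv.Perm (Fin N)) = α ∘ σ := by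
        ext j; simp
      rw [(kp_main α).1 a b hab hlt, J_dem hab,
        ih _ (msr_lt hab hlt) _ rfl (Equiv.swap a b * σ) (by rw [e]; exact hσ), e]

theorem kp_sym {N : ℕ} {α : Fin N → ℤ} (h : Monotone α) {a b : Fin N} (hab : adj a b) :
    sw a b (kp α) = kp α := by
  rcases (h hab.lt.le).lt_or_eq with h1 | h1
  · rw [(kp_main α).1 a b hab h1]; exact sw_dem hab.ne _
  · rw [← (kp_main α).2 a b hab h1]; exact sw_dem hab.ne _

theorem sym_of_adj {N : ℕ} {f : LR N} (h : ∀ a b, adj a b → sw a b f = f)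
    (σ : Equiv.Perm (Fin N)) : act σ f = f := by
  cases N with
  | zero => rw [Subsingleton.elim σ 1, act_one]
  | succ n =>
    have hσ : σ ∈ Submonoid.closure
        (Set.range fun i : Fin n => Equiv.swap i.castSucc i.succ) := by
      rw [Equiv.Perm.mclosure_swap_castSucc_succ]; trivial
    induction hσ using Submonoid.closure_induction with
    | mem x hx => obtain ⟨i, rfl⟩ := hx; exact h _ _ (by simp [adj])
    | one => exact act_one f
    | mul x y _ _ hx hy => rw [← act_act, hy, hx]

theorem J_mul_sym {N : ℕ} {g : LR N} (hg : ∀ σ, act σ g = g) (f : LR N) : J (f * g) = J f * g := by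
  rw [J_apply, J_apply, Finset.sum_mul]
  apply Finset.sum_congr rfl
  intro σ _
  rw [map_mul, hg, smul_mul_assoc]

def rh {N : ℕ} : Fin N → ℤ := fun i => (N : ℤ) - (i : ℕ)

theorem J_S {N : ℕ} {lam : Fin N → ℤ} (h : Antitone lam) :
    J (mono (-rh)) * kp (-lam) = J (mono (-(lam + rh))) := by
  have hm : Monotone (-lam) := h.neg
  have hS : ∀ σ, act σ (kp (-lam)) = kp (-lam) := sym_of_adj fun a b hab => kp_sym hm hab
  have hA : Antitone ((-lam) ∘ Fin.revPerm) := by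
    intro a b hab
    exact hm (by simpa using hab)
  have e1 := J_kp (-lam) Fin.revPerm hA
  rw [J_mul_sym hS, mono_mul] at e1
  have hrev : ∀ γ : Fin N → ℤ, (mono (γ ∘ Fin.revPerm) : LR N) = act Fin.revPerm (mono γ) := by
    intro γ; rw [act_mono]; rfl
  have hd : (dl : Fin N → ℤ) = (-rh) ∘ Fin.revPerm := by
    ext i; have := i.isLt; simp [dl, rh, Fin.val_rev]
  have hd2 : (dl + (-lam) ∘ Fin.revPerm : Fin N → ℤ) = (-(lam + rh)) ∘ Fin.revPerm := by
    rw [hd]; ext i; simp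
  rw [hd2, hd, hrev, hrev, J_act, J_act, smul_mul_assoc] at e1
  rcases Int.units_eq_one_or (Equiv.Perm.sign (Fin.revPerm : Equiv.Perm (Fin N))) with h | h
  · rw [h] at e1; simpa using e1
  · rw [h] at e1; simpa using e1

noncomputable def Dl {N : ℕ} : LR N := mono rh * J (mono (-rh))

theorem Dl_S {N : ℕ} {lam : Fin N → ℤ} (h : Antitone lam) :
    Dl * kp (-lam) = ∑ σ : Equiv.Perm (Fin N), (Equiv.Perm.sign σ : ℤ) •
      mono (fun i => rh i - (lam + rh : Fin N → ℤ) (σ⁻¹ i)) := by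
  rw [Dl, mul_assoc, J_S h, J_apply, Finset.mul_sum]
  apply Finset.sum_congr rfl
  intro σ _
  rw [act_mono, mul_smul_comm, mono_mul]
  rfl

theorem kp_mem {N : ℕ} {P : (Fin N → ℤ) → Prop} {α : Fin N → ℤ}
    (h : ∀ ν σ, ν = α ∘ (σ : Equiv.Perm (Fin N)) → P ν) : kp α ∈ Cn P := by
  induction hn : msr α using Nat.strong_induction_on generalizing α with
  | _ n ih =>
    subst hn
    by_cases hA : Antitone α
    · rw [kp, key_dom _ _ hA]; exact (Wd.base _ hA (h α 1 rfl)).mem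
    · obtain ⟨a, b, hab, hlt⟩ := exists_ascent hA
      rw [(kp_main α).1 a b hab hlt]
      apply Cn_dem hab
      apply ih _ (msr_lt hab hlt) _ rfl
      intro ν σ hν
      exact h ν (Equiv.swap a b * σ) (by rw [hν]; rfl)

theorem S_mul_mem {N : ℕ} {lam : Fin N → ℤ} (h : Antitone lam) {f : LR N}
    (hf : f ∈ Cn (PT (N := N))) : kp (-lam) * f ∈ Cn (PT (N := N)) := by
  refine Cn_map (mulL (kp (-lam))) ?_ hf
  intro f hf
  rw [mulL_apply]
  induction hf with
  | base ν hν _ => rw [mul_comm]; exact mult_dom hν (kp_mem fun _ _ _ => trivial)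
  | step a b hab f hf ih =>
    rw [← dem_mul_sym hab.ne (kp_sym (α := -lam) h.neg hab)]
    exact Cn_dem hab ih

end

section
/-- monomial with natural exponents -/
noncomputable def monoN {N : ℕ} (a : Fin N → ℕ) : LR N := mono (fun i => (a i : ℤ))

/-- complete homogeneous functions in the variables of `s` -/
noncomputable def H {N : ℕ} (s : Finset (Fin N)) (c : ℤ) : LR N :=
  if 0 ≤ c then ∑ a ∈ Finset.piAntidiag s c.toNat, monoN a else 0

theorem H_neg {N : ℕ} (s : Finset (Fin N)) {c : ℤ} (h : c < 0) : (H s c : LR N) = 0 := by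
  rw [H, if_neg (not_le.mpr h)]

theorem H_nat {N : ℕ} (s : Finset (Fin N)) (n : ℕ) :
    (H s n : LR N) = ∑ a ∈ Finset.piAntidiag s n, monoN a := by
  rw [H, if_pos (by omega)]; simp

theorem H_zero {N : ℕ} (s : Finset (Fin N)) : (H s 0 : LR N) = 1 := by
  have := H_nat s 0
  simp only [Nat.cast_zero] at this
  rw [this, Finset.piAntidiag_zero, Finset.sum_singleton]
  rfl

theorem H_empty {N : ℕ} {c : ℤ} (h : c ≠ 0) : (H (∅ : Finset (Fin N)) c : LR N) = 0 := by
  rcases lt_or_ge c 0 with h1 | h1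
  · exact H_neg _ h1
  · lift c to ℕ using h1
    rw [H_nat, Finset.piAntidiag_empty_of_ne_zero (by simpa using h), Finset.sum_empty]

theorem H_rec {N : ℕ} {s : Finset (Fin N)} {j : Fin N} (hj : j ∉ s) (c : ℤ) :
    (H (insert j s) c : LR N) = H s c + xv j * H (insert j s) (c - 1) := by
  rcases lt_trichotomy c 0 with h | h | h
  · rw [H_neg _ h, H_neg _ h, H_neg _ (by omega)]; simp
  · subst h; rw [H_zero, H_zero, H_neg _ (by omega)]; simp
  · obtain ⟨n, rfl⟩ : ∃ n : ℕ, c = (n + 1 : ℕ) := ⟨(c - 1).toNat, by push_cast; omega⟩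
    have e : ((n + 1 : ℕ) : ℤ) - 1 = (n : ℕ) := by push_cast; ring
    rw [e, H_nat, H_nat, H_nat, Finset.mul_sum,
      ← Finset.sum_filter_add_sum_filter_not _ (fun a => a j = 0)]
    congr 1
    · apply Finset.sum_congr _ (fun _ _ => rfl)
      ext a
      simp only [Finset.mem_filter, Finset.mem_piAntidiag, Finset.sum_insert hj, Finset.mem_insert]
      constructor
      · rintro ⟨⟨h1, h2⟩, h3⟩
        have h1 : a j + s.sum a = n + 1 := h1
        refine ⟨by omega, fun i hi => ?_⟩
        rcases h2 i hi with rfl | h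
        · exact absurd h3 hi
        · exact h
      · rintro ⟨h1, h2⟩
        have h3 : a j = 0 := by by_contra h; exact hj (h2 j h)
        exact ⟨⟨by show a j + s.sum a = n + 1; omega, fun i hi => Or.inr (h2 i hi)⟩, h3⟩
    · symm
      refine Finset.sum_bij' (fun a _ => a + Pi.single j 1) (fun a _ => a - Pi.single j 1) ?_ ?_ ?_ ?_ ?_
      · intro a ha
        simp only [Finset.mem_filter, Finset.mem_piAntidiag, Finset.mem_insert] at ha ⊢
        refine ⟨⟨?_, ?_⟩, by simp⟩
        · rw [← ha.1]
          simp [Finset.sum_add_distrib]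
        · intro i hi
          by_cases hij : i = j
          · exact Or.inl hij
          · exact ha.2 i (by simpa [hij] using hi)
      · intro a ha
        simp only [Finset.mem_filter, Finset.mem_piAntidiag, Finset.mem_insert] at ha ⊢
        refine ⟨?_, ?_⟩
        · have h2 : ∑ i ∈ insert j s, ((a - Pi.single j 1 : Fin N → ℕ) i + (Pi.single j 1 : Fin N → ℕ) i) = n + 1 := by
            rw [← ha.1.1]
            apply Finset.sum_congr rfl
            intro i _
            by_cases hij : i = j
            · subst hij; simp; omega
            · simp [hij]
          rw [Finset.sum_add_distrib] at h2
          simpa using h2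
        · intro i hi
          apply ha.1.2 i
          intro h; simp [h] at hi
      · intro a ha; ext i; simp
      · intro a ha
        simp only [Finset.mem_filter] at ha
        ext i
        by_cases hij : i = j
        · subst hij; simp; omega
        · simp [hij]
      · intro a ha
        rw [xv, monoN, monoN, mono_mul]; congr 1; ext i
        by_cases hij : i = j
        · subst hij; simp; ring
        · simp [hij]

theorem act_H {N : ℕ} (σ : Equiv.Perm (Fin N)) (s : Finset (Fin N)) (hs : ∀ i, σ i ∈ s ↔ i ∈ s)
    (c : ℤ) : act σ (H s c) = H s c := by
  rcases lt_or_ge c 0 with h | h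
  · rw [H_neg _ h]; simp
  · lift c to ℕ using h
    rw [H_nat, map_sum]
    have hs' : ∀ i, σ⁻¹ i ∈ s ↔ i ∈ s := fun i => by rw [← hs]; simp
    have hs'' : ∀ i, σ.symm i ∈ s ↔ i ∈ s := hs'
    refine Finset.sum_bij' (fun a _ => fun i => a (σ⁻¹ i)) (fun a _ => fun i => a (σ i)) ?_ ?_ ?_ ?_ ?_
    · intro a ha
      rw [Finset.mem_piAntidiag] at *
      refine ⟨?_, fun i hi => (hs' i).mp (ha.2 _ hi)⟩
      rw [← ha.1]
      apply Finset.sum_bij' (fun i _ => σ⁻¹ i) (fun i _ => σ i) <;> simp [hs, hs'']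
    · intro a ha
      rw [Finset.mem_piAntidiag] at *
      refine ⟨?_, fun i hi => (hs i).mp (ha.2 _ hi)⟩
      rw [← ha.1]
      apply Finset.sum_bij' (fun i _ => σ i) (fun i _ => σ⁻¹ i) <;> simp [hs, hs'']
    · intro a _; ext; simp
    · intro a _; ext; simp
    · intro a _; rw [monoN, act_mono]; rfl

/-- flagged substitution -/
noncomputable def Qf {N : ℕ} (fl : Fin N → Finset (Fin N)) : LR N →ₗ[ℤ] LR N :=
  lin (fun c => ∏ k, H (fl k) (c k))

theorem Qf_mono {N : ℕ} (fl : Fin N → Finset (Fin N)) (c : Fin N → ℤ) :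
    Qf fl (mono c) = ∏ k, H (fl k) (c k) := lin_mono _ _

def fl0 {N : ℕ} : Fin N → Finset (Fin N) := fun k => Finset.Iic k
def fl1 {N : ℕ} (i j : Fin N) : Fin N → Finset (Fin N) :=
  fun k => if k = i then Finset.Iic j else Finset.Iic k

noncomputable def Q {N : ℕ} : LR N →ₗ[ℤ] LR N := Qf fl0

/-- the linear map given by the action -/
noncomputable def actL {N : ℕ} (σ : Equiv.Perm (Fin N)) : LR N →ₗ[ℤ] LR N :=
  (act σ).toAddMonoidHom.toIntLinearMap

theorem actL_apply {N : ℕ} (σ : Equiv.Perm (Fin N)) (f : LR N) : actL σ f = act σ f := rfl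

theorem adj_le_iff {N : ℕ} {i j k : Fin N} (hij : adj i j) (hk : k ≠ i) : i ≤ k ↔ j ≤ k := by
  unfold adj at hij; rw [Fin.le_def, Fin.le_def]
  have : (k : ℕ) ≠ i := fun h => hk (Fin.ext h)
  omega

theorem Q_eq {N : ℕ} {i j : Fin N} (hij : adj i j) (f : LR N) :
    Q f = Qf (fl1 i j) f - xv j * Qf (fl1 i j) (mono (- Pi.single i 1) * f) := by
  have := lin_ext (A := Q) (B := Qf (fl1 i j) -
    (mulL (xv j)).comp ((Qf (fl1 i j)).comp (mulL (mono (- Pi.single i 1))))) ?_ f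
  · exact this
  intro γ
  have e0 : (mono (- Pi.single i 1) : LR N) * mono γ = mono (fun k => if k = i then γ k - 1 else γ k) := by
    rw [mono_mul]; congr 1; ext k
    by_cases hk : k = i
    · subst hk; simp; ring
    · simp [hk]
  simp only [LinearMap.sub_apply, LinearMap.comp_apply, mulL_apply, e0]
  rw [Q, Qf_mono, Qf_mono, Qf_mono]
  rw [← Finset.mul_prod_erase _ _ (Finset.mem_univ i),
    ← Finset.mul_prod_erase _ (fun k => H (fl1 i j k) (γ k)) (Finset.mem_univ i),
    ← Finset.mul_prod_erase _ (fun k => H (fl1 i j k) (if k = i then γ k - 1 else γ k))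
      (Finset.mem_univ i)]
  have e1 : ∏ k ∈ Finset.univ.erase i, (H (fl1 i j k) (γ k) : LR N) =
      ∏ k ∈ Finset.univ.erase i, H (fl0 k) (γ k) := by
    apply Finset.prod_congr rfl; intro k hk
    simp at hk; simp [fl1, fl0, hk]
  have e2 : ∏ k ∈ Finset.univ.erase i, (H (fl1 i j k) (if k = i then γ k - 1 else γ k) : LR N) =
      ∏ k ∈ Finset.univ.erase i, H (fl0 k) (γ k) := by
    apply Finset.prod_congr rfl; intro k hk
    simp at hk; simp [fl1, fl0, hk]
  rw [e1, e2]
  have e3 : fl1 i j i = insert j (fl0 i) := by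
    ext k
    unfold adj at hij
    simp only [fl1, fl0, if_true, Finset.mem_Iic, Finset.mem_insert, Fin.le_def, Fin.ext_iff]
    omega
  have hj : j ∉ fl0 i := by simp [fl0, hij.lt]
  rw [e3, if_pos rfl, H_rec hj (γ i)]
  ring

theorem Q1_sw {N : ℕ} {i j : Fin N} (hij : adj i j) (f : LR N) :
    Qf (fl1 i j) (sw i j f) = Qf (fl1 i j) f := by
  refine lin_ext (A := (Qf (fl1 i j)).comp (actL (Equiv.swap i j))) (B := Qf (fl1 i j)) ?_ f
  intro γ
  rw [LinearMap.comp_apply, actL_apply, act_mono, Qf_mono, Qf_mono]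
  apply Fintype.prod_equiv (Equiv.swap i j)
  intro k
  congr 1
  simp only [fl1, Equiv.swap_apply_def]
  split_ifs <;> simp_all

theorem sw_Q1 {N : ℕ} {i j : Fin N} (hij : adj i j) (f : LR N) :
    sw i j (Qf (fl1 i j) f) = Qf (fl1 i j) f := by
  refine lin_ext (A := (actL (Equiv.swap i j)).comp (Qf (fl1 i j))) (B := Qf (fl1 i j)) ?_ f
  intro γ
  rw [LinearMap.comp_apply, actL_apply, Qf_mono, map_prod]
  apply Finset.prod_congr rfl
  intro k _
  apply act_H
  intro l
  have h0 := hij.lt.le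
  have key : i ∈ fl1 i j k ↔ j ∈ fl1 i j k := by
    unfold fl1
    split_ifs with h
    · simp [h0]
    · simp [adj_le_iff hij h]
  rw [Equiv.swap_apply_def]
  split_ifs with h1 h2
  · rw [h1, key]
  · rw [h2, key]
  · rfl

/-- the operator `E` -/
noncomputable def Ef {N : ℕ} (g : LR N) : LR N := Q (Dl * g)

theorem Ef_add {N : ℕ} (f g : LR N) : Ef (f + g) = Ef f + Ef g := by simp [Ef, mul_add]

theorem Dl_split {N : ℕ} {i j : Fin N} (hij : adj i j) :
    ∃ B : LR N, Dl = xv i * B ∧ mono (- Pi.single i 1) * (Dl : LR N) = B ∧ sw i j B = -B := by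
  refine ⟨mono (- Pi.single i 1) * Dl, ?_, rfl, ?_⟩
  · rw [← mul_assoc, xv, mono_mul, add_neg_cancel, mono_zero, one_mul]
  · rw [Dl, ← mul_assoc, mono_mul, map_mul, sw_J hij.ne, sw_mono_eq]
    · ring
    · have := hij.ne
      unfold adj at hij
      simp [rh, this.symm]; omega

theorem Ef_dem {N : ℕ} {i j : Fin N} (hij : adj i j) (g : LR N) :
    Ef (dem i j g) = dem i j (Ef g) := by
  have hne := hij.ne
  obtain ⟨B, hB, hB2, hs⟩ := Dl_split hij
  have e1 : dem i j (Ef g) = Qf (fl1 i j) (Dl * g) := by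
    rw [Ef, Q_eq hij, map_sub, dem_of_sym hne (sw_Q1 hij _), dem_xb hne (sw_Q1 hij _), sub_zero]
  rw [e1, Ef, Q_eq hij, ← mul_assoc, hB2]
  have e2 : Qf (fl1 i j) (B * dem i j g) = 0 := by
    apply self_add_zero
    nth_rewrite 1 [← Q1_sw hij]
    rw [map_mul (sw i j), hs, sw_dem hne, neg_mul, map_neg]; ring
  rw [e2, mul_zero, sub_zero]
  have e3 : Dl * dem i j g + sw i j (Dl * dem i j g) = Dl * g + sw i j (Dl * g) := by
    rw [hB]
    simp only [map_mul (sw i j), sw_left, hs, sw_dem hne]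
    linear_combination B * dem_spec hne g
  have e4 := congrArg (Qf (fl1 i j)) e3
  rw [map_add, map_add, Q1_sw hij, Q1_sw hij] at e4
  exact add_self_inj e4

theorem Ef_mono {N : ℕ} (γ : Fin N → ℤ) : Ef (mono γ) = ∑ σ : Equiv.Perm (Fin N),
    (Equiv.Perm.sign σ : ℤ) • ∏ k, (H (fl0 k) (γ k + rh k - rh (σ⁻¹ k)) : LR N) := by
  rw [Ef, Dl, J_apply, Finset.mul_sum, Finset.sum_mul, map_sum]
  apply Finset.sum_congr rfl
  intro σ _
  rw [act_mono, mul_smul_comm, smul_mul_assoc, map_zsmul, mono_mul, mono_mul, Q, Qf_mono]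
  congr 1
  apply Finset.prod_congr rfl
  intro k _
  congr 1
  simp; ring

theorem Ef_one {N : ℕ} : Ef (mono 0 : LR N) = mono 0 := by
  rw [Ef_mono, Finset.sum_eq_single 1]
  · simp [H_zero, mono_zero]
  · intro σ _ hσ
    obtain ⟨k, hk⟩ : ∃ k, (σ⁻¹ k) < k := by
      by_contra hc
      push Not at hc
      apply hσ
      have h1 : ∑ k : Fin N, (k : ℕ) = ∑ k : Fin N, ((σ⁻¹ k : Fin N) : ℕ) :=
        (Equiv.sum_comp σ⁻¹ (fun k : Fin N => (k : ℕ))).symm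
      have h2 := (Finset.sum_eq_sum_iff_of_le (fun k _ => Fin.le_def.mp (hc k))).mp h1
      ext k
      have := h2 (σ k) (Finset.mem_univ _)
      simp at this ⊢
      rw [this]
    rw [Finset.prod_eq_zero (Finset.mem_univ k), smul_zero]
    apply H_neg
    simp [rh]; exact hk
  · simp

theorem Ef_neg {N : ℕ} {ν : Fin N → ℤ} (hν : Antitone ν) {i : Fin N} (hi : ν i < 0) :
    Ef (mono ν) = 0 := by
  rw [Ef_mono]
  apply Finset.sum_eq_zero
  intro σ _
  have hN : 0 < N := i.pos
  let l : Fin N := ⟨N - 1, by omega⟩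
  rw [Finset.prod_eq_zero (Finset.mem_univ l), smul_zero]
  apply H_neg
  have h1 : ν l ≤ ν i := hν (by rw [Fin.le_def]; simp [l]; omega)
  have h2 := (σ⁻¹ l).isLt
  have h3 : (l : ℕ) = N - 1 := rfl
  simp only [rh, h3]
  omega

theorem Ef_x0 {N : ℕ} {z : Fin N} (hz : (z : ℕ) = 0) {γ : Fin N → ℤ} (hγ : 0 ≤ γ z) :
    Ef (xv z * mono γ) = xv z * Ef (mono γ) := by
  rw [xv, mono_mul, Ef_mono, Ef_mono, Finset.mul_sum]
  apply Finset.sum_congr rfl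
  intro σ _
  rw [mul_smul_comm]
  congr 1
  rw [← Finset.mul_prod_erase _ _ (Finset.mem_univ z),
    ← Finset.mul_prod_erase _ (fun k => H (fl0 k) (γ k + rh k - rh (σ⁻¹ k))) (Finset.mem_univ z),
    ← mul_assoc]
  congr 1
  · have e : fl0 z = insert z ∅ := by
      ext k; simp [fl0, Fin.le_def, Fin.ext_iff, hz]
    have h1 : 0 ≤ γ z + rh z - rh (σ⁻¹ z) := by simp only [rh, hz]; omega
    rw [e, H_rec (by simp), H_empty]
    · rw [zero_add, xv]; congr 2; simp; ring
    · simp only [Pi.add_apply, Pi.single_eq_same]; omega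
  · apply Finset.prod_congr rfl
    intro k hk
    simp at hk
    simp [hk]

theorem Ef_x {N : ℕ} (n : ℕ) : ∀ (a : Fin N), (a : ℕ) = n → ∀ (γ : Fin N → ℤ), (∀ i, 0 ≤ γ i) →
    Ef (xv a * mono γ) = xv a * Ef (mono γ) := by
  induction n with
  | zero => intro a ha γ hγ; exact Ef_x0 ha (hγ a)
  | succ n ih =>
    intro b hb
    have hbl := b.isLt
    obtain ⟨a, ha⟩ : ∃ a : Fin N, (a : ℕ) = n := ⟨⟨n, by omega⟩, rfl⟩
    have hab : adj a b := by unfold adj; omega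
    have hne := hab.ne
    have ih' := ih a ha
    intro γ hγ
    induction hd : (γ a + γ b).toNat using Nat.strong_induction_on generalizing γ with
    | _ d ihd =>
      subst hd
      have case1 : ∀ δ : Fin N → ℤ, (∀ i, 0 ≤ δ i) → 1 ≤ δ a → δ a + δ b = γ a + γ b →
          Ef (xv b * mono δ) = xv b * Ef (mono δ) := by
        intro δ hδ h1 h2
        have hδ' : ∀ i, 0 ≤ (δ - Pi.single a 1 : Fin N → ℤ) i := by
          intro i
          by_cases hia : i = a
          · subst hia; simpa using h1
          · simpa [hia] using hδ i
        have e : (mono δ : LR N) = xv a * mono (δ - Pi.single a 1) := by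
          rw [xv, mono_mul]; congr 1; abel
        have h3 : Ef (xv b * mono (δ - Pi.single a 1)) = xv b * Ef (mono (δ - Pi.single a 1)) := by
          apply ihd _ _ _ hδ' rfl
          have := hγ a; have := hγ b; have := hδ b
          simp [hne.symm]; omega
        have h4 : Ef (xv a * (xv b * mono (δ - Pi.single a 1))) =
            xv a * Ef (xv b * mono (δ - Pi.single a 1)) := by
          rw [show (xv b : LR N) = mono (Pi.single b 1) from rfl, mono_mul]
          apply ih'
          intro i; have := hδ' i
          by_cases hib : i = b
          · subst hib; simp at *; omega
          · simpa [hib] using this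
        rw [e, ih' _ hδ', mul_left_comm, h4, h3]; ring
      by_cases h0 : 1 ≤ γ a
      · exact case1 γ hγ h0 rfl
      have h0' : γ a = 0 := by have := hγ a; omega
      obtain ⟨q, hq⟩ := Int.eq_ofNat_of_zero_le (hγ b)
      -- reflected monomial
      let η : Fin N → ℤ := fun i => γ (Equiv.swap a b i)
      have hηa : η a = q := by simp [η, hq]
      have hηb : η b = 0 := by simp [η, h0']
      have hη : ∀ i, 0 ≤ η i := fun i => hγ _
      have hstr := dem_string hne q η (by rw [hηa, hηb]; ring)
      rw [Finset.sum_range_succ] at hstr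
      have hlast : η - Pi.single a (q : ℤ) + Pi.single b (q : ℤ) = γ := by
        ext i
        by_cases hia : i = a
        · subst hia; simp [hηa, hne, h0']
        · by_cases hib : i = b
          · subst hib; simp [hηb, hia, hq]
          · simp [hia, hib, η, Equiv.swap_apply_of_ne_of_ne hia hib]
      rw [hlast] at hstr
      have hdx : ∀ f : LR N, xv b * dem a b f = dem a b (xv a * f) - xv a * f := by
        intro f
        apply mul_left_cancel₀ (xv_sub_ne hne)
        have h1 := dem_spec hne (xv a * f)
        rw [map_mul (sw a b), sw_left] at h1
        linear_combination xv b * dem_spec hne f - h1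
      have hfull : Ef (xv b * dem a b (mono η)) = xv b * Ef (dem a b (mono η)) := by
        rw [Ef_dem hab, hdx, hdx, ← ih' η hη, ← Ef_dem hab]
        simp [Ef, mul_sub]
      have hsum : ∀ s : Finset ℕ, (∀ k ∈ s, k < q) →
          Ef (xv b * ∑ k ∈ s, mono (η - Pi.single a (k : ℤ) + Pi.single b (k : ℤ))) =
          xv b * Ef (∑ k ∈ s, mono (η - Pi.single a (k : ℤ) + Pi.single b (k : ℤ))) := by
        intro s
        induction s using Finset.induction_on with
        | empty => intro _; simp [Ef]
        | insert k s hk ihs =>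
          intro h
          have hkq := h k (Finset.mem_insert_self _ _)
          rw [Finset.sum_insert hk, mul_add, Ef_add, Ef_add, mul_add,
            ihs (fun k hk => h k (Finset.mem_insert_of_mem hk)), case1]
          · intro i
            have := hη i
            by_cases hia : i = a
            · subst hia; simp [hne, hηa]; omega
            · by_cases hib : i = b
              · subst hib; simp [hηb, hia]
              · simpa [hia, hib] using this
          · simp [hne, hηa]; omega
          · simp [hne, hne.symm, hηa, hηb, h0', hq]
      rw [hstr, mul_add, Ef_add, Ef_add, hsum _ (fun k hk => Finset.mem_range.mp hk)] at hfull
      linear_combination hfull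

theorem Ef_pos {N : ℕ} {γ : Fin N → ℤ} (hγ : ∀ i, 0 ≤ γ i) : Ef (mono γ) = mono γ := by
  induction hd : (∑ i, γ i).toNat generalizing γ with
  | zero =>
    have h0 : ∑ i, γ i = 0 := by
      have := Finset.sum_nonneg (fun i (_ : i ∈ Finset.univ) => hγ i); omega
    have : γ = 0 := by
      ext i
      exact (Finset.sum_eq_zero_iff_of_nonneg (fun i _ => hγ i)).mp h0 i (Finset.mem_univ i)
    rw [this, Ef_one]
  | succ d ih =>
    obtain ⟨i, hi⟩ : ∃ i, 1 ≤ γ i := by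
      by_contra hc
      push Not at hc
      have : ∑ i, γ i = 0 := Finset.sum_eq_zero (fun i _ => by have := hc i; have := hγ i; omega)
      rw [this] at hd; simp at hd
    have hδ' : ∀ k, 0 ≤ (γ - Pi.single i 1 : Fin N → ℤ) k := by
      intro k
      by_cases hik : k = i
      · subst hik; simpa using hi
      · simpa [hik] using hγ k
    have e : (mono γ : LR N) = xv i * mono (γ - Pi.single i 1) := by
      rw [xv, mono_mul]; congr 1; abel
    rw [e, Ef_x _ i rfl _ hδ', ih hδ']
    simp [Finset.sum_sub_distrib]
    omega

noncomputable def EfL {N : ℕ} : LR N →ₗ[ℤ] LR N := Q.comp (mulL Dl)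

theorem Ef_mem {N : ℕ} {f : LR N} (hf : f ∈ Cn (PT (N := N))) : Ef f ∈ Cn (PN (N := N)) := by
  refine Cn_map EfL ?_ hf
  intro f hf
  show Ef f ∈ _
  induction hf with
  | base ν hν _ =>
    by_cases h : ∀ i, 0 ≤ ν i
    · rw [Ef_pos h]; exact (Wd.base _ hν h).mem
    · push Not at h
      obtain ⟨i, hi⟩ := h
      rw [Ef_neg hν hi]; exact AddSubmonoid.zero_mem _
  | step a b hab f hf ih => rw [Ef_dem hab]; exact Cn_dem hab ih

end

section
/-- honest polynomials -/
noncomputable def Pol {N : ℕ} : AddSubgroup (LR N) :=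
  AddSubgroup.closure {f | ∃ γ : Fin N → ℤ, (∀ i, 0 ≤ γ i) ∧ f = mono γ}

theorem Pol_mono {N : ℕ} {γ : Fin N → ℤ} (h : ∀ i, 0 ≤ γ i) : (mono γ : LR N) ∈ Pol :=
  AddSubgroup.subset_closure ⟨γ, h, rfl⟩

theorem Pol_ind {N : ℕ} (p : LR N → Prop) (h0 : p 0) (hadd : ∀ f g, p f → p g → p (f + g))
    (hneg : ∀ f, p f → p (-f)) (hm : ∀ γ, (∀ i, 0 ≤ γ i) → p (mono γ)) {f : LR N} (hf : f ∈ Pol) :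
    p f := by
  induction hf using AddSubgroup.closure_induction with
  | mem x hx => obtain ⟨γ, hγ, rfl⟩ := hx; exact hm γ hγ
  | zero => exact h0
  | add x y _ _ hx hy => exact hadd x y hx hy
  | neg x _ hx => exact hneg x hx

theorem Pol_mul {N : ℕ} {f g : LR N} (hf : f ∈ Pol) (hg : g ∈ Pol) : f * g ∈ Pol := by
  refine Pol_ind (fun f => f * g ∈ Pol) ?_ ?_ ?_ ?_ hf
  · simp [AddSubgroup.zero_mem]
  · intro a b ha hb; rw [add_mul]; exact AddSubgroup.add_mem _ ha hb
  · intro a ha; rw [neg_mul]; exact AddSubgroup.neg_mem _ ha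
  intro γ hγ
  refine Pol_ind (fun g => mono γ * g ∈ Pol) ?_ ?_ ?_ ?_ hg
  · simp [AddSubgroup.zero_mem]
  · intro a b ha hb; rw [mul_add]; exact AddSubgroup.add_mem _ ha hb
  · intro a ha; rw [mul_neg]; exact AddSubgroup.neg_mem _ ha
  intro δ hδ
  rw [mono_mul]
  exact Pol_mono fun i => add_nonneg (hγ i) (hδ i)

theorem Pol_dem_string {N : ℕ} {a b : Fin N} (hne : a ≠ b) {γ : Fin N → ℤ} (h : ∀ i, 0 ≤ γ i)
    (hle : γ b ≤ γ a) : dem a b (mono γ) ∈ Pol := by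
  obtain ⟨n, hn⟩ := Int.eq_ofNat_of_zero_le (sub_nonneg.mpr hle)
  rw [dem_string hne n γ (by omega)]
  apply AddSubgroup.sum_mem
  intro k hk
  rw [Finset.mem_range] at hk
  apply Pol_mono
  intro i
  have h1 := h i; have h2 := h b
  by_cases hia : i = a
  · subst hia; simp [hne]; omega
  · by_cases hib : i = b
    · subst hib; simp [hia]; omega
    · simpa [hia, hib] using h1

theorem Pol_dem {N : ℕ} {a b : Fin N} (hne : a ≠ b) {f : LR N} (hf : f ∈ Pol) :
    dem a b f ∈ Pol := by
  refine Pol_ind (fun f => dem a b f ∈ Pol) ?_ ?_ ?_ ?_ hf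
  · simp [AddSubgroup.zero_mem]
  · intro a b ha hb; rw [map_add]; exact AddSubgroup.add_mem _ ha hb
  · intro a ha; rw [map_neg]; exact AddSubgroup.neg_mem _ ha
  intro γ hγ
  by_cases hle : γ b ≤ γ a
  · exact Pol_dem_string hne hγ hle
  · have h1 := dem_add_sw hne (sw a b (mono γ))
    rw [sw_sw] at h1
    rw [h1, act_mono]
    refine AddSubgroup.sub_mem _ (AddSubgroup.add_mem _ (Pol_mono fun i => hγ _) (Pol_mono hγ)) ?_
    apply Pol_dem_string hne (fun i => hγ _)
    simp; omega

theorem Wd.pol {N : ℕ} {f : LR N} (hf : Wd PN f) : f ∈ Pol := by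
  induction hf with
  | base ν _ hν => exact Pol_mono hν
  | step a b hab f _ ih => exact Pol_dem hab.ne ih

/-- delete the coordinate `k`, append `0` -/
def skip {N : ℕ} (k : Fin N) (γ : Fin N → ℤ) : Fin N → ℤ :=
  fun i => if i < k then γ i else if h : (i : ℕ) + 1 < N then γ ⟨i + 1, h⟩ else 0

noncomputable def sub {N : ℕ} (k : Fin N) : LR N →ₗ[ℤ] LR N :=
  lin (fun γ => if γ k = 0 then mono (skip k γ) else 0)

theorem sub_mono {N : ℕ} (k : Fin N) (γ : Fin N → ℤ) :
    sub k (mono γ) = if γ k = 0 then mono (skip k γ) else 0 := lin_mono _ _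

/-- the renaming of the surviving variables -/
def lab {N : ℕ} (k l l' : Fin N) : Prop := (l < k ∧ l' = l) ∨ (k < l ∧ (l' : ℕ) + 1 = l)

theorem lab.ne {N : ℕ} {k l l' : Fin N} (h : lab k l l') : l ≠ k := by
  rcases h with h | h
  · exact h.1.ne
  · exact h.1.ne'

theorem skip_lab {N : ℕ} {k l l' : Fin N} (h : lab k l l') (γ : Fin N → ℤ) :
    skip k γ l' = γ l := by
  unfold skip
  rcases h with ⟨h1, rfl⟩ | ⟨h1, h2⟩
  · rw [if_pos h1]
  · rw [if_neg (by rw [Fin.lt_def] at *; omega), dif_pos (by omega)]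
    congr 1; exact Fin.ext h2

/-- every index but the last is a label -/
theorem lab_cases {N : ℕ} (k l' : Fin N) : (∃ l, lab k l l') ∨ (∀ γ, skip k γ l' = 0) := by
  by_cases h : l' < k
  · exact Or.inl ⟨l', Or.inl ⟨h, rfl⟩⟩
  · by_cases h2 : (l' : ℕ) + 1 < N
    · refine Or.inl ⟨⟨l' + 1, h2⟩, Or.inr ⟨?_, rfl⟩⟩
      rw [Fin.lt_def] at *; simp; omega
    · right; intro γ; simp [skip, h, h2]

theorem lab_inj {N : ℕ} {k l m l' : Fin N} (h : lab k l l') (h2 : lab k m l') : l = m := by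
  rcases h with ⟨a, b⟩ | ⟨a, b⟩ <;> rcases h2 with ⟨c, d⟩ | ⟨c, d⟩
  · rw [← b, d]
  · subst b; rw [Fin.lt_def] at *; omega
  · subst d; rw [Fin.lt_def] at *; omega
  · exact Fin.ext (by omega)

theorem lab_inj' {N : ℕ} {k l l' m' : Fin N} (h : lab k l l') (h2 : lab k l m') : l' = m' := by
  rcases h with ⟨a, b⟩ | ⟨a, b⟩ <;> rcases h2 with ⟨c, d⟩ | ⟨c, d⟩
  · rw [b, d]
  · rw [Fin.lt_def] at *; omega
  · rw [Fin.lt_def] at *; omega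
  · exact Fin.ext (by omega)

theorem skip_last {N : ℕ} {k l l' : Fin N} (h : lab k l l') :
    ¬ (∀ γ : Fin N → ℤ, skip k γ l' = 0) := by
  intro hc
  have := hc (fun _ => 1)
  rw [skip_lab h] at this
  simp at this

theorem skip_add {N : ℕ} (k : Fin N) (γ δ : Fin N → ℤ) : skip k (γ + δ) = skip k γ + skip k δ := by
  ext i; simp only [skip, Pi.add_apply]; split_ifs <;> simp

theorem skip_single {N : ℕ} {k l l' : Fin N} (h : lab k l l') (c : ℤ) :
    skip k (Pi.single l c) = Pi.single l' c := by
  ext i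
  rcases lab_cases k i with ⟨m, hm⟩ | hm
  · rw [skip_lab hm]
    by_cases hlm : m = l
    · subst hlm
      have := lab_inj' h hm; subst this; simp
    · have : i ≠ l' := by rintro rfl; exact hlm (lab_inj hm h)
      simp [hlm, this]
  · rw [hm]
    have : i ≠ l' := by rintro rfl; exact skip_last h hm
    simp [this]

theorem sub_x {N : ℕ} {k l l' : Fin N} (h : lab k l l') (g : LR N) :
    sub k (xv l * g) = xv l' * sub k g := by
  refine lin_ext (A := (sub k).comp (mulL (xv l))) (B := (mulL (xv l')).comp (sub k)) ?_ g
  intro γ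
  simp only [LinearMap.comp_apply, mulL_apply]
  rw [xv, mono_mul, sub_mono, sub_mono]
  have h1 : (Pi.single l 1 + γ : Fin N → ℤ) k = γ k := by simp [h.ne.symm]
  rw [h1]
  split_ifs
  · rw [xv, mono_mul, skip_add, skip_single h]
  · simp

theorem sub_xk {N : ℕ} (k : Fin N) {g : LR N} (hg : g ∈ Pol) : sub k (xv k * g) = 0 := by
  refine Pol_ind (fun g => sub k (xv k * g) = 0) ?_ ?_ ?_ ?_ hg
  · simp
  · intro f g hf hg; rw [mul_add, map_add, hf, hg, add_zero]
  · intro f hf; rw [mul_neg, map_neg, hf, neg_zero]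
  · intro γ hγ
    rw [xv, mono_mul, sub_mono, if_neg]
    have := hγ k
    simp; omega

theorem sub_sw {N : ℕ} {k i j i' j' : Fin N} (hi : lab k i i') (hj : lab k j j') (f : LR N) :
    sub k (sw i j f) = sw i' j' (sub k f) := by
  refine lin_ext (A := (sub k).comp (actL (Equiv.swap i j)))
    (B := (actL (Equiv.swap i' j')).comp (sub k)) ?_ f
  intro γ
  simp only [LinearMap.comp_apply, actL_apply]
  rw [act_mono, sub_mono, sub_mono]
  have h1 : (Equiv.swap i j)⁻¹ k = k := by
    rw [Equiv.swap_inv, Equiv.swap_apply_of_ne_of_ne hi.ne.symm hj.ne.symm]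
  rw [h1]
  split_ifs
  · rw [act_mono]
    congr 1
    ext m'
    simp only [Equiv.swap_inv]
    by_cases h2 : m' = i'
    · subst h2
      rw [Equiv.swap_apply_left, skip_lab hi, skip_lab hj, Equiv.swap_apply_left]
    by_cases h3 : m' = j'
    · subst h3
      rw [Equiv.swap_apply_right, skip_lab hi, skip_lab hj, Equiv.swap_apply_right]
    rw [Equiv.swap_apply_of_ne_of_ne h2 h3]
    rcases lab_cases k m' with ⟨m, hm⟩ | hm
    · rw [skip_lab hm, skip_lab hm, Equiv.swap_apply_of_ne_of_ne]
      · rintro rfl; exact h2 (lab_inj' hm hi)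
      · rintro rfl; exact h3 (lab_inj' hm hj)
    · rw [hm, hm]
  · simp

theorem sub_sw_adj {N : ℕ} {i j : Fin N} (hij : adj i j) (f : LR N) :
    sub i (sw i j f) = sub j f := by
  refine lin_ext (A := (sub i).comp (actL (Equiv.swap i j))) (B := sub j) ?_ f
  intro γ
  simp only [LinearMap.comp_apply, actL_apply]
  rw [act_mono, sub_mono, sub_mono]
  simp only [Equiv.swap_inv, Equiv.swap_apply_left]
  split_ifs
  · congr 1
    ext m
    unfold skip
    have h0 := hij.lt
    by_cases h1 : m < i
    · rw [if_pos h1, if_pos (h1.trans h0)]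
      simp only [Equiv.swap_apply_of_ne_of_ne h1.ne (h1.trans h0).ne]
    · rw [if_neg h1]
      by_cases h2 : m = i
      · subst h2
        have h3 : (m : ℕ) + 1 < N := by unfold adj at hij; rw [hij]; exact j.isLt
        have h4 : (⟨m + 1, h3⟩ : Fin N) = j := Fin.ext hij
        rw [dif_pos h3, if_pos h0, h4]
        simp only [Equiv.swap_apply_right]
      · have h2' : (m : ℕ) ≠ i := fun h => h2 (Fin.ext h)
        have h5 : ¬ m < j := by unfold adj at hij; rw [Fin.lt_def] at *; omega
        rw [if_neg h5]
        split_ifs with h6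
        · beta_reduce
          rw [Equiv.swap_apply_of_ne_of_ne]
          · intro h; rw [Fin.ext_iff] at h; simp at h; rw [Fin.lt_def] at h1; omega
          · intro h; rw [Fin.ext_iff] at h; simp at h; unfold adj at hij; omega
        · rfl
  · rfl

theorem sub_dem_far {N : ℕ} {k i j i' j' : Fin N} (hne : i ≠ j) (hne' : i' ≠ j') (hi : lab k i i')
    (hj : lab k j j') (f : LR N) : sub k (dem i j f) = dem i' j' (sub k f) := by
  symm
  apply dem_unique hne'
  have := congrArg (sub k) (dem_spec hne f)
  rw [sub_mul, map_sub, map_sub, sub_x hi, sub_x hj, sub_x hi, sub_x hj, sub_sw hi hj] at this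
  rw [sub_mul, this]

theorem sub_dem_left {N : ℕ} {i j : Fin N} (hij : adj i j) {f : LR N} (hf : f ∈ Pol) :
    sub i (dem i j f) = sub j f := by
  have hne := hij.ne
  have hj : lab i j i := Or.inr ⟨hij.lt, hij⟩
  have := congrArg (sub i) (dem_spec hne f)
  rw [sub_mul, map_sub, map_sub, sub_xk i (Pol_dem hne hf), sub_xk i hf, sub_x hj, sub_x hj,
    sub_sw_adj hij] at this
  apply mul_left_cancel₀ (xv_ne_zero i)
  linear_combination -this

theorem Pol_act {N : ℕ} (σ : Equiv.Perm (Fin N)) {f : LR N} (hf : f ∈ Pol) : act σ f ∈ Pol := by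
  refine Pol_ind (fun f => act σ f ∈ Pol) ?_ ?_ ?_ ?_ hf
  · simp [AddSubgroup.zero_mem]
  · intro a b ha hb; rw [map_add]; exact AddSubgroup.add_mem _ ha hb
  · intro a ha; rw [map_neg]; exact AddSubgroup.neg_mem _ ha
  intro γ hγ
  rw [act_mono]; exact Pol_mono fun i => hγ _

theorem sub_dem_right {N : ℕ} {i j : Fin N} (hij : adj i j) {f : LR N} (hf : f ∈ Pol) :
    sub j (dem i j f) = sub j f := by
  have hne := hij.ne
  have hi : lab j i i := Or.inl ⟨hij.lt, rfl⟩
  have := congrArg (sub j) (dem_spec hne f)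
  rw [sub_mul, map_sub, map_sub, sub_xk j (Pol_dem hne hf), sub_xk j (Pol_act _ hf), sub_x hi,
    sub_x hi] at this
  apply mul_left_cancel₀ (xv_ne_zero i)
  linear_combination this

theorem sub_Wd {N : ℕ} {f : LR N} (hf : Wd PN f) : ∀ k, sub k f ∈ Cn (PN (N := N)) := by
  induction hf with
  | base ν hν hP =>
    intro k
    rw [sub_mono]
    split_ifs with h
    · apply Wd.mem
      have hz : ∀ l, k ≤ l → ν l = 0 := fun l hl => le_antisymm (h ▸ hν hl) (hP l)
      have e : skip k ν = fun i => if i < k then ν i else 0 := by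
        ext i; unfold skip
        split_ifs with h1 h2
        · rfl
        · apply hz; rw [Fin.lt_def] at h1; rw [Fin.le_def]; simp; omega
        · rfl
      rw [e]
      refine Wd.base _ ?_ ?_
      · intro a b hab
        simp only
        split_ifs with h1 h2
        · exact hν hab
        · exact absurd (lt_of_le_of_lt hab h1) h2
        · exact hP _
        · rfl
      · intro i; simp only; split_ifs
        · exact hP i
        · rfl
    · exact AddSubmonoid.zero_mem _
  | step i j hij f hf ih =>
    intro k
    have hne := hij.ne
    have hij' : (i : ℕ) + 1 = j := hij
    by_cases h1 : k = i
    · subst h1; rw [sub_dem_left hij hf.pol]; exact ih j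
    by_cases h2 : k = j
    · subst h2; rw [sub_dem_right hij hf.pol]; exact ih k
    by_cases h3 : j < k
    · rw [sub_dem_far hne hne (Or.inl ⟨hij.lt.trans h3, rfl⟩) (Or.inl ⟨h3, rfl⟩)]
      exact Cn_dem hij (ih k)
    · have h1' : (k : ℕ) ≠ i := fun h => h1 (Fin.ext h)
      have h2' : (k : ℕ) ≠ j := fun h => h2 (Fin.ext h)
      have h4 : k < i := by rw [Fin.lt_def] at *; omega
      have h5 : (k : ℕ) < i := h4
      have hil := i.isLt
      let i' : Fin N := ⟨i - 1, by omega⟩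
      have hi' : adj i' i := by simp [adj, i']; omega
      rw [sub_dem_far hne hi'.ne (Or.inr ⟨h4, hi'⟩) (Or.inr ⟨h4.trans hij.lt, hij⟩)]
      exact Cn_dem hi' (ih k)

theorem sub_mem {N : ℕ} (k : Fin N) {f : LR N} (hf : f ∈ Cn (PN (N := N))) :
    sub k f ∈ Cn (PN (N := N)) := Cn_map (sub k) (fun _ hg => sub_Wd hg k) hf

theorem sub_mul_pol {N : ℕ} (k : Fin N) {f g : LR N} (hf : f ∈ Pol) (hg : g ∈ Pol) :
    sub k (f * g) = sub k f * sub k g := by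
  refine Pol_ind (fun f => sub k (f * g) = sub k f * sub k g) ?_ ?_ ?_ ?_ hf
  · simp
  · intro a b ha hb; rw [add_mul, map_add, map_add, ha, hb, add_mul]
  · intro a ha; rw [neg_mul, map_neg, map_neg, ha, neg_mul]
  intro γ hγ
  refine Pol_ind (fun g => sub k (mono γ * g) = sub k (mono γ) * sub k g) ?_ ?_ ?_ ?_ hg
  · simp
  · intro a b ha hb; rw [mul_add, map_add, map_add, ha, hb, mul_add]
  · intro a ha; rw [mul_neg, map_neg, map_neg, ha, mul_neg]
  intro δ hδ
  rw [mono_mul, sub_mono, sub_mono, sub_mono, skip_add]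
  have h1 := hγ k; have h2 := hδ k
  by_cases h3 : γ k = 0
  · by_cases h4 : δ k = 0
    · simp [h3, h4, mono_mul]
    · simp [h3, h4]
  · have : (γ + δ) k ≠ 0 := by simp; omega
    rw [if_neg this, if_neg h3, zero_mul]

end

section
theorem coeff_mono {N : ℕ} (γ δ : Fin N → ℤ) :
    (mono γ : LR N).coeff δ = if γ = δ then 1 else 0 := by
  classical
  simp [mono, Finsupp.single_apply]

/-- nonnegative exponents of total degree `d` -/
def In {N : ℕ} (d : ℕ) (γ : Fin N → ℤ) : Prop := (∀ i, 0 ≤ γ i) ∧ ∑ i, γ i = d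

theorem In_swap {N : ℕ} {d : ℕ} {γ : Fin N → ℤ} (h : In d γ) (σ : Equiv.Perm (Fin N)) :
    In d (γ ∘ σ) :=
  ⟨fun i => h.1 _, by rw [← h.2]; exact Equiv.sum_comp σ γ⟩

theorem In_string {N : ℕ} {d : ℕ} {a b : Fin N} (hne : a ≠ b) {γ : Fin N → ℤ} (h : In d γ)
    {k : ℕ} (hk : (k : ℤ) ≤ γ a - γ b) :
    In d (γ - Pi.single a (k : ℤ) + Pi.single b (k : ℤ)) := by
  refine ⟨fun i => ?_, ?_⟩
  · have h1 := h.1 i; have h2 := h.1 b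
    by_cases hia : i = a
    · subst hia; simp [hne]; omega
    · by_cases hib : i = b
      · subst hib; simp [hia]; omega
      · simpa [hia, hib] using h1
  · rw [← h.2]
    simp [Finset.sum_add_distrib, Finset.sum_sub_distrib]

noncomputable def Hd {N : ℕ} (d : ℕ) : AddSubgroup (LR N) :=
  AddSubgroup.closure {f | ∃ γ : Fin N → ℤ, In d γ ∧ f = mono γ}

theorem Hd_mono {N d : ℕ} {γ : Fin N → ℤ} (h : In d γ) : (mono γ : LR N) ∈ Hd d :=
  AddSubgroup.subset_closure ⟨γ, h, rfl⟩

theorem Hd_dem_string {N d : ℕ} {a b : Fin N} (hne : a ≠ b) {γ : Fin N → ℤ} (h : In d γ)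
    (hle : γ b ≤ γ a) : dem a b (mono γ) ∈ Hd d := by
  obtain ⟨n, hn⟩ := Int.eq_ofNat_of_zero_le (sub_nonneg.mpr hle)
  rw [dem_string hne n γ (by omega)]
  apply AddSubgroup.sum_mem
  intro k hk
  rw [Finset.mem_range] at hk
  exact Hd_mono (In_string hne h (by omega))

theorem Hd_dem {N d : ℕ} {a b : Fin N} (hne : a ≠ b) {f : LR N} (hf : f ∈ Hd d) :
    dem a b f ∈ Hd d := by
  induction hf using AddSubgroup.closure_induction with
  | mem x hx =>
    obtain ⟨γ, hγ, rfl⟩ := hx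
    by_cases hle : γ b ≤ γ a
    · exact Hd_dem_string hne hγ hle
    · have h1 := dem_add_sw hne (sw a b (mono γ))
      rw [sw_sw] at h1
      rw [h1, act_mono]
      have h2 := In_swap hγ (Equiv.swap a b)⁻¹
      refine AddSubgroup.sub_mem _ (AddSubgroup.add_mem _ (Hd_mono h2) (Hd_mono hγ)) ?_
      apply Hd_dem_string hne h2
      simp; omega
  | zero => simp [AddSubgroup.zero_mem]
  | add x y _ _ hx hy => rw [map_add]; exact AddSubgroup.add_mem _ hx hy
  | neg x _ hx => rw [map_neg]; exact AddSubgroup.neg_mem _ hx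

theorem Hd_coeff {N d : ℕ} {f : LR N} (hf : f ∈ Hd d) {δ : Fin N → ℤ} (h : ¬ In d δ) :
    f.coeff δ = 0 := by
  induction hf using AddSubgroup.closure_induction with
  | mem x hx =>
    obtain ⟨γ, hγ, rfl⟩ := hx
    rw [coeff_mono, if_neg]; rintro rfl; exact h hγ
  | zero => simp
  | add x y _ _ hx hy => simp [hx, hy]
  | neg x _ hx => simp [hx]

theorem kp_dom {N : ℕ} {α : Fin N → ℤ} (h : Antitone α) : kp α = mono α := by
  rw [kp, key_dom _ _ h]

theorem kp_Hd {N d : ℕ} {α : Fin N → ℤ} (h : In d α) : kp α ∈ Hd d := by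
  induction hn : msr α using Nat.strong_induction_on generalizing α with
  | _ n ih =>
    subst hn
    by_cases hA : Antitone α
    · rw [kp_dom hA]; exact Hd_mono h
    · obtain ⟨a, b, hab, hlt⟩ := exists_ascent hA
      rw [(kp_main α).1 a b hab hlt]
      exact Hd_dem hab.ne (ih _ (msr_lt hab hlt) (In_swap h _) rfl)

/-- a Demazure operator sends a key to a key -/
theorem dem_kp {N : ℕ} {a b : Fin N} (hab : adj a b) (α : Fin N → ℤ) :
    ∃ σ : Equiv.Perm (Fin N), dem a b (kp α) = kp (α ∘ σ) := by
  rcases lt_trichotomy (α a) (α b) with h | h | h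
  · refine ⟨1, ?_⟩
    have h1 := (kp_main α).1 a b hab h
    have : α ∘ (1 : Equiv.Perm (Fin N)) = α := rfl
    rw [this, h1, dem_idem hab.ne]
  · exact ⟨1, (kp_main α).2 a b hab h⟩
  · refine ⟨Equiv.swap a b, ?_⟩
    have h1 := (kp_main (α ∘ Equiv.swap a b)).1 a b hab (by simpa using h)
    rw [h1, swap_swap_comp]

noncomputable def Kd {N : ℕ} (d : ℕ) : AddSubgroup (LR N) :=
  AddSubgroup.closure {f | ∃ γ : Fin N → ℤ, In d γ ∧ f = kp γ}

theorem Kd_kp {N d : ℕ} {γ : Fin N → ℤ} (h : In d γ) : (kp γ : LR N) ∈ Kd d :=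
  AddSubgroup.subset_closure ⟨γ, h, rfl⟩

theorem Kd_dem {N d : ℕ} {a b : Fin N} (hab : adj a b) {f : LR N} (hf : f ∈ Kd d) :
    dem a b f ∈ Kd d := by
  induction hf using AddSubgroup.closure_induction with
  | mem x hx =>
    obtain ⟨γ, hγ, rfl⟩ := hx
    obtain ⟨σ, hσ⟩ := dem_kp hab γ
    rw [hσ]; exact Kd_kp (In_swap hγ σ)
  | zero => simp [AddSubgroup.zero_mem]
  | add x y _ _ hx hy => rw [map_add]; exact AddSubgroup.add_mem _ hx hy
  | neg x _ hx => rw [map_neg]; exact AddSubgroup.neg_mem _ hx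

def nsq {N : ℕ} (γ : Fin N → ℤ) : ℕ := ∑ i, (γ i * γ i).toNat

theorem nsq_swap {N : ℕ} (γ : Fin N → ℤ) (σ : Equiv.Perm (Fin N)) : nsq (γ ∘ σ) = nsq γ :=
  Equiv.sum_comp σ (fun i => (γ i * γ i).toNat)

theorem nsq_cast {N : ℕ} (γ : Fin N → ℤ) : (nsq γ : ℤ) = ∑ i, γ i * γ i := by
  rw [nsq, Nat.cast_sum]
  exact Finset.sum_congr rfl fun i _ => Int.toNat_of_nonneg (mul_self_nonneg _)

theorem nsq_string {N : ℕ} {a b : Fin N} (hne : a ≠ b) (γ : Fin N → ℤ) (k : ℤ)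
    (h1 : 0 < k) (h2 : k < γ a - γ b) :
    nsq (γ - Pi.single a k + Pi.single b k) < nsq γ := by
  zify
  rw [nsq_cast, nsq_cast, ← sub_pos, ← Finset.sum_sub_distrib,
    ← Finset.add_sum_erase _ _ (Finset.mem_univ a),
    ← Finset.add_sum_erase (a := b) (Finset.univ.erase a) _ (by simp [hne.symm])]
  rw [Finset.sum_eq_zero (s := (Finset.univ.erase a).erase b)]
  · simp [hne, hne.symm]
    nlinarith
  · intro i hi
    simp at hi
    simp [hi.1, hi.2]

theorem mono_Kd {N d : ℕ} {γ : Fin N → ℤ} (h : In d γ) : (mono γ : LR N) ∈ Kd d := by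
  induction hm : nsq γ using Nat.strong_induction_on generalizing γ with
  | _ m ihm =>
  induction hn : msr γ using Nat.strong_induction_on generalizing γ with
  | _ n ih =>
    by_cases hA : Antitone γ
    · rw [← kp_dom hA]; exact Kd_kp h
    · obtain ⟨a, b, hab, hlt⟩ := exists_ascent hA
      have hne := hab.ne
      set β : Fin N → ℤ := γ ∘ Equiv.swap a b with hβ
      have hba : β a = γ b := by simp [hβ]
      have hbb : β b = γ a := by simp [hβ]
      have hIβ : In d β := In_swap h _
      obtain ⟨n', hn'⟩ : ∃ n' : ℕ, β a = β b + (n' + 1 : ℕ) :=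
        ⟨(γ b - γ a - 1).toNat, by rw [hba, hbb]; push_cast; omega⟩
      have hs := dem_string hne (n' + 1) β hn'
      rw [Finset.sum_range_succ, Finset.sum_range_succ'] at hs
      have e0 : β - Pi.single a ((0 : ℕ) : ℤ) + Pi.single b ((0 : ℕ) : ℤ) = β := by simp
      have e1 : β - Pi.single a ((n' + 1 : ℕ) : ℤ) + Pi.single b ((n' + 1 : ℕ) : ℤ) = γ := by
        ext i
        by_cases hia : i = a
        · subst hia
          simp only [Pi.add_apply, Pi.sub_apply, Pi.single_eq_same, Pi.single_eq_of_ne hne]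
          omega
        · by_cases hib : i = b
          · subst hib
            simp only [Pi.add_apply, Pi.sub_apply, Pi.single_eq_same, Pi.single_eq_of_ne hia]
            omega
          · simp [hia, hib, hβ, Equiv.swap_apply_of_ne_of_ne hia hib]
      rw [e0, e1] at hs
      have hβK : (mono β : LR N) ∈ Kd d :=
        ih _ (hn ▸ msr_lt hab hlt) hIβ (by rw [hβ, nsq_swap, hm]) rfl
      have : (mono γ : LR N) = dem a b (mono β) - (∑ k ∈ Finset.range n',
          mono (β - Pi.single a ((k + 1 : ℕ) : ℤ) + Pi.single b ((k + 1 : ℕ) : ℤ)) + mono β) := by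
        rw [hs]; ring
      rw [this]
      refine AddSubgroup.sub_mem _ (Kd_dem hab hβK) (AddSubgroup.add_mem _ ?_ hβK)
      apply AddSubgroup.sum_mem
      intro k hk
      rw [Finset.mem_range] at hk
      refine ihm _ ?_ (In_string hne hIβ (by omega)) rfl
      rw [← hm, ← nsq_swap γ (Equiv.swap a b), ← hβ]
      exact nsq_string hne β _ (by omega) (by omega)

/-- words are keys -/
theorem Wd.kp_eq {N : ℕ} {f : LR N} (hf : Wd PN f) : ∃ α : Fin N → ℤ, (∀ i, 0 ≤ α i) ∧ f = kp α := by
  induction hf with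
  | base ν hν hP => exact ⟨ν, hP, (kp_dom hν).symm⟩
  | step a b hab f _ ih =>
    obtain ⟨α, h1, rfl⟩ := ih
    obtain ⟨σ, hσ⟩ := dem_kp hab α
    exact ⟨α ∘ σ, fun i => h1 _, hσ⟩

/-- natural exponents to integers -/
def cz {N : ℕ} (a : Fin N → ℕ) : Fin N → ℤ := fun i => (a i : ℤ)

/-- index set of the degree `d` part -/
def Idx {N : ℕ} (d : ℕ) : Finset (Fin N → ℕ) := Finset.piAntidiag Finset.univ d

theorem mem_Idx {N d : ℕ} {a : Fin N → ℕ} : a ∈ Idx d ↔ ∑ i, a i = d := by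
  simp [Idx, Finset.mem_piAntidiag]

theorem In_cz {N d : ℕ} {a : Fin N → ℕ} : In d (cz a) ↔ a ∈ Idx d := by
  rw [mem_Idx]
  constructor
  · intro h
    have := h.2
    simp only [cz] at this
    exact_mod_cast this
  · intro h
    refine ⟨fun i => by simp [cz], ?_⟩
    simp only [cz]
    exact_mod_cast h

theorem cz_inj {N : ℕ} {a b : Fin N → ℕ} (h : cz a = cz b) : a = b := by
  ext i
  have := congrFun h i
  simpa [cz] using this

theorem In_exists {N : ℕ} {γ : Fin N → ℤ} (h : ∀ i, 0 ≤ γ i) : ∃ a : Fin N → ℕ, γ = cz a :=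
  ⟨fun i => (γ i).toNat, by ext i; simp [cz, h i]⟩

/-- transition matrix -/
noncomputable def Pm {N : ℕ} (b α : Fin N → ℕ) : ℤ := (kp (cz α) : LR N).coeff (cz b)

theorem Cn_comb {N d : ℕ} {f : LR N} (hf : f ∈ Cn (PN (N := N))) :
    ∃ n : (Fin N → ℕ) → ℤ, (∀ α, 0 ≤ n α) ∧
      ∀ b ∈ Idx d, f.coeff (cz b) = ∑ α ∈ Idx d, Pm b α * n α := by
  classical
  induction hf using AddSubmonoid.closure_induction with
  | mem x hx =>
    obtain ⟨γ, hγ, rfl⟩ := Wd.kp_eq hx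
    obtain ⟨a, rfl⟩ := In_exists hγ
    by_cases ha : a ∈ Idx d
    · refine ⟨fun α => if α = a then 1 else 0, fun α => by positivity, fun b hb => ?_⟩
      simp [ha, Pm]
    · refine ⟨0, fun α => le_rfl, fun b hb => ?_⟩
      simp only [Pi.zero_apply, mul_zero, Finset.sum_const_zero]
      have h1 : In (∑ i, a i) (cz a) := In_cz.mpr (mem_Idx.mpr rfl)
      apply Hd_coeff (kp_Hd h1)
      rw [In_cz, mem_Idx]
      rw [mem_Idx] at hb ha
      omega
  | zero => exact ⟨0, fun α => le_rfl, fun b hb => by simp⟩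
  | add x y _ _ hx hy =>
    obtain ⟨n, h1, h2⟩ := hx
    obtain ⟨m, h3, h4⟩ := hy
    refine ⟨n + m, fun α => add_nonneg (h1 α) (h3 α), fun b hb => ?_⟩
    simp [h2 b hb, h4 b hb, mul_add, Finset.sum_add_distrib]

theorem Kd_comb {N d : ℕ} {f : LR N} (hf : f ∈ Kd d) :
    ∃ n : (Fin N → ℕ) → ℤ, f = ∑ α ∈ Idx d, n α • kp (cz α) := by
  classical
  induction hf using AddSubgroup.closure_induction with
  | mem x hx =>
    obtain ⟨γ, hγ, rfl⟩ := hx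
    obtain ⟨a, rfl⟩ := In_exists hγ.1
    refine ⟨fun α => if α = a then 1 else 0, ?_⟩
    have := In_cz.mp hγ
    simp [this]
  | zero => exact ⟨0, by simp⟩
  | add x y _ _ hx hy =>
    obtain ⟨n, h1⟩ := hx
    obtain ⟨m, h2⟩ := hy
    refine ⟨n + m, ?_⟩
    rw [h1, h2]; simp [add_smul, Finset.sum_add_distrib]
  | neg x _ hx =>
    obtain ⟨n, h1⟩ := hx
    refine ⟨-n, ?_⟩
    rw [h1]; simp

/-- inverse of the transition matrix -/
theorem Rm_exists (N d : ℕ) : ∃ R : (Fin N → ℕ) → (Fin N → ℕ) → ℤ,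
    (∀ b ∈ Idx d, (monoN b : LR N) = ∑ α ∈ Idx d, R α b • kp (cz α)) ∧
    (∀ α ∈ Idx d, ∀ α' ∈ Idx d, ∑ b ∈ Idx d, R α b * Pm b α' = if α = α' then 1 else 0) := by
  classical
  have h1 : ∀ b : Fin N → ℕ, ∃ n : (Fin N → ℕ) → ℤ, b ∈ Idx d →
      (monoN b : LR N) = ∑ α ∈ Idx d, n α • kp (cz α) := by
    intro b
    by_cases hb : b ∈ Idx d
    · obtain ⟨n, hn⟩ := Kd_comb (mono_Kd (In_cz.mpr hb))
      exact ⟨n, fun _ => hn⟩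
    · exact ⟨0, fun h => absurd h hb⟩
  choose n hn using h1
  refine ⟨fun α b => n b α, hn, ?_⟩
  let A : Matrix (Idx (N := N) d) (Idx (N := N) d) ℤ := fun b α => Pm b.1 α.1
  let B : Matrix (Idx (N := N) d) (Idx (N := N) d) ℤ := fun α b => n b.1 α.1
  have hAB : A * B = 1 := by
    ext ⟨b', hb'⟩ ⟨b, hb⟩
    rw [Matrix.mul_apply]
    have := congrArg (fun g : LR N => g.coeff (cz b')) (hn b hb)
    simp only [monoN] at this
    have h3 : (mono (fun i => (b i : ℤ)) : LR N).coeff (cz b') = if b = b' then 1 else 0 := by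
      rw [coeff_mono]
      by_cases h : b = b'
      · subst h; rw [if_pos rfl]; exact if_pos rfl
      · rw [if_neg, if_neg h]; intro h4; exact h (cz_inj h4)
    rw [h3] at this
    simp only [A, B]
    rw [Finset.sum_coe_sort (Idx d) (fun α => Pm b' α * n b α)]
    have h5 : (∑ α ∈ Idx d, n b α • (kp (cz α) : LR N)).coeff (cz b') =
        ∑ α ∈ Idx d, Pm b' α * n b α := by
      rw [AddMonoidAlgebra.coeff_sum, Finset.sum_apply']
      apply Finset.sum_congr rfl
      intro α _
      rw [AddMonoidAlgebra.coeff_smul_apply, smul_eq_mul, mul_comm]; rfl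
    rw [← h5, ← this, Matrix.one_apply]
    simp [eq_comm]
  have hBA := mul_eq_one_comm.mp hAB
  intro α hα α' hα'
  show ∑ b ∈ Idx d, n b α * Pm b α' = _
  have := congrFun (congrFun hBA ⟨α, hα⟩) ⟨α', hα'⟩
  rw [Matrix.mul_apply, Matrix.one_apply] at this
  simp only [A, B] at this
  rw [Finset.sum_coe_sort (Idx d) (fun b => n b α * Pm b α')] at this
  rw [this]; simp

end

section
theorem cyclic {ι κ : Type*} [Fintype ι] [DecidableEq ι] [DecidableEq κ] (c : Equiv.Perm ι)
    (I : ι → Finset κ) (P R n T : ι → κ → κ → ℤ) (hn : ∀ s x y, 0 ≤ n s x y)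
    (hRP : ∀ s, ∀ α ∈ I s, ∀ α' ∈ I s, ∑ b ∈ I s, R s α b * P s b α' = if α = α' then 1 else 0)
    (hT : ∀ s, ∀ b' ∈ I (c s), ∀ b ∈ I s, T s b' b =
      ∑ x ∈ I (c s), ∑ α ∈ I s, P (c s) b' x * n s x α * R s α b) :
    0 ≤ ∑ b ∈ Fintype.piFinset I, ∏ s, T s (b (c s)) (b s) := by
  have h1 : ∀ b ∈ Fintype.piFinset I, ∏ s, T s (b (c s)) (b s) =
      ∑ q ∈ Fintype.piFinset (fun s => I (c s) ×ˢ I s), (∏ s, n s (q s).1 (q s).2) *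
        ∏ s, (R s (q s).2 (b s) * P s (b s) (q (c.symm s)).1) := by
    intro b hb
    rw [Fintype.mem_piFinset] at hb
    have : ∀ s, T s (b (c s)) (b s) = ∑ p ∈ I (c s) ×ˢ I s,
        P (c s) (b (c s)) p.1 * n s p.1 p.2 * R s p.2 (b s) := by
      intro s
      rw [hT s _ (hb _) _ (hb _), Finset.sum_product]
    rw [Finset.prod_congr rfl fun s _ => this s, Finset.prod_univ_sum]
    apply Finset.sum_congr rfl
    intro q _
    rw [Finset.prod_mul_distrib, Finset.prod_mul_distrib, Finset.prod_mul_distrib]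
    have h2 : ∏ s, P (c s) (b (c s)) (q s).1 = ∏ s, P s (b s) (q (c.symm s)).1 := by
      rw [← Equiv.prod_comp c (fun s => P s (b s) (q (c.symm s)).1)]
      simp
    rw [h2]; ring
  rw [Finset.sum_congr rfl h1, Finset.sum_comm]
  apply Finset.sum_nonneg
  intro q hq
  rw [Fintype.mem_piFinset] at hq
  rw [← Finset.mul_sum]
  apply mul_nonneg
  · exact Finset.prod_nonneg fun s _ => hn _ _ _
  rw [← Finset.prod_univ_sum I (fun s b => R s (q s).2 b * P s b (q (c.symm s)).1)]
  apply Finset.prod_nonneg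
  intro s _
  have h3 := (Finset.mem_product.mp (hq s)).2
  have h4 := (Finset.mem_product.mp (hq (c.symm s))).1
  rw [Equiv.apply_symm_apply] at h4
  rw [hRP s _ h3 _ h4]
  split_ifs <;> simp

theorem H_Pol {N : ℕ} (s : Finset (Fin N)) (c : ℤ) : (H s c : LR N) ∈ Pol := by
  rw [H]
  split_ifs
  · exact AddSubgroup.sum_mem _ fun a _ => Pol_mono fun i => by positivity
  · exact AddSubgroup.zero_mem _

theorem sub_one {N : ℕ} (k : Fin N) : sub k (1 : LR N) = 1 := by
  rw [← mono_zero, sub_mono]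
  refine (if_pos rfl).trans ?_
  congr 1
  ext i; simp [skip]

theorem sub_H_empty {N : ℕ} (k : Fin N) (c : ℤ) : sub k (H ∅ c : LR N) = H ∅ c := by
  by_cases h : c = 0
  · subst h; rw [H_zero, sub_one]
  · rw [H_empty h, map_zero]

theorem sub_H {N : ℕ} (z : Fin N) (hz : (z : ℕ) = 0) (n : ℕ) : ∀ k : Fin N, (k : ℕ) = n →
    ∀ c : ℤ, sub z (H (Finset.Iic k) c : LR N) = H (Finset.Iio k) c := by
  induction n with
  | zero =>
    intro k hk c
    have : k = z := Fin.ext (by omega)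
    subst this
    have e1 : Finset.Iic k = insert k ∅ := by
      ext i; simp only [Finset.mem_Iic, Finset.mem_Iio, Finset.mem_insert, Finset.notMem_empty, or_false, iff_false, Fin.ext_iff]; rw [Fin.le_def]; omega
    have e2 : Finset.Iio k = ∅ := by
      ext i; simp only [Finset.mem_Iic, Finset.mem_Iio, Finset.mem_insert, Finset.notMem_empty, or_false, iff_false, Fin.ext_iff]; rw [Fin.lt_def]; omega
    rw [e2, e1, H_rec (by simp), map_add, sub_H_empty, sub_xk k (H_Pol _ _), add_zero]
  | succ n ih =>
    intro k hk
    have hkl := k.isLt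
    let k' : Fin N := ⟨n, by omega⟩
    have hk' : (k' : ℕ) = n := rfl
    have e1 : Finset.Iic k = insert k (Finset.Iic k') := by
      ext i; simp only [Finset.mem_Iic, Finset.mem_Iio, Finset.mem_insert, Finset.notMem_empty, or_false, iff_false, Fin.ext_iff]; rw [Fin.le_def, Fin.le_def]; omega
    have e2 : Finset.Iio k = insert k' (Finset.Iio k') := by
      ext i; simp only [Finset.mem_Iic, Finset.mem_Iio, Finset.mem_insert, Finset.notMem_empty, or_false, iff_false, Fin.ext_iff]; rw [Fin.lt_def, Fin.lt_def]; omega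
    have hlab : lab z k k' := Or.inr ⟨by rw [Fin.lt_def]; omega, by omega⟩
    have key : ∀ m : ℕ, ∀ c : ℤ, c < m →
        sub z (H (Finset.Iic k) c : LR N) = H (Finset.Iio k) c := by
      intro m
      induction m with
      | zero => intro c hc; rw [H_neg _ (by simpa using hc), H_neg _ (by simpa using hc), map_zero]
      | succ m ihm =>
        intro c hc
        rw [e1, H_rec (by rw [Finset.mem_Iic, Fin.le_def]; omega), map_add, ih k' hk', sub_x hlab, ← e1,
          ihm (c - 1) (by push_cast at hc; omega), e2, ← H_rec (by simp)]
    intro c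
    exact key (c.toNat + 1) c (by push_cast; omega)

theorem sub_prod {N : ℕ} (z : Fin N) {ι : Type*} (s : Finset ι) (F : ι → LR N)
    (hF : ∀ i, F i ∈ Pol) : sub z (∏ i ∈ s, F i) = ∏ i ∈ s, sub z (F i) ∧ ∏ i ∈ s, F i ∈ Pol := by
  classical
  induction s using Finset.induction_on with
  | empty =>
    refine ⟨by simp [sub_one], ?_⟩
    rw [Finset.prod_empty, ← mono_zero]; exact Pol_mono fun i => le_rfl
  | insert a s ha ih =>
    rw [Finset.prod_insert ha, Finset.prod_insert ha]
    exact ⟨by rw [sub_mul_pol z (hF a) ih.2, ih.1], Pol_mul (hF a) ih.2⟩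

/-- the flags -/
def flg {N : ℕ} (st : Bool) : Fin N → Finset (Fin N) :=
  fun k => if st then Finset.Iio k else Finset.Iic k

theorem sub_Q {N : ℕ} (z : Fin N) (hz : (z : ℕ) = 0) (f : LR N) :
    sub z (Q f) = Qf (flg true) f := by
  refine lin_ext (A := (sub z).comp Q) (B := Qf (flg true)) ?_ f
  intro γ
  rw [LinearMap.comp_apply, Q, Qf_mono, Qf_mono, (sub_prod z _ _ fun i => H_Pol _ _).1]
  exact Finset.prod_congr rfl fun k _ => sub_H z hz _ k rfl _

theorem Cn_PN_PT {N : ℕ} {f : LR N} (hf : f ∈ Cn (PN (N := N))) : f ∈ Cn (PT (N := N)) := by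
  refine Cn_map (LinearMap.id) ?_ hf
  intro f hf
  rw [LinearMap.id_apply]
  induction hf with
  | base ν hν _ => exact (Wd.base ν hν trivial).mem
  | step a b hab f _ ih => exact Cn_dem hab ih

/-- the transfer operator -/
noncomputable def Wop {N : ℕ} (st : Bool) (mu lam : Fin N → ℤ) : LR N →ₗ[ℤ] LR N :=
  (Qf (flg st)).comp (mulL (mono mu * (Dl * kp (-lam))))

theorem Wop_apply {N : ℕ} (st : Bool) (mu lam : Fin N → ℤ) (f : LR N) :
    Wop st mu lam f = Qf (flg st) (mono mu * (Dl * kp (-lam)) * f) := rfl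

theorem Wop_mem {N : ℕ} (hN : 1 ≤ N) (st : Bool) {mu lam : Fin N → ℤ} (hmu : Antitone mu)
    (hlam : Antitone lam) {f : LR N} (hf : f ∈ Cn (PN (N := N))) :
    Wop st mu lam f ∈ Cn (PN (N := N)) := by
  have h1 : Q (mono mu * (Dl * kp (-lam)) * f) ∈ Cn (PN (N := N)) := by
    have := Ef_mem (mult_dom hmu (S_mul_mem hlam (Cn_PN_PT hf)))
    rw [Ef] at this
    convert this using 2
    ring
  rw [Wop_apply]
  cases st with
  | false => exact h1
  | true =>
    rw [← sub_Q ⟨0, hN⟩ rfl]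
    exact sub_mem _ h1

noncomputable def Tm {N : ℕ} (st : Bool) (mu lam : Fin N → ℤ) (b' b : Fin N → ℕ) : ℤ :=
  (Wop st mu lam (monoN b)).coeff (cz b')

theorem coeff_sum_smul {N : ℕ} {ι : Type*} (s : Finset ι) (n : ι → ℤ) (F : ι → LR N)
    (δ : Fin N → ℤ) : (∑ i ∈ s, n i • F i).coeff δ = ∑ i ∈ s, n i * (F i).coeff δ := by
  rw [AddMonoidAlgebra.coeff_sum, Finset.sum_apply']
  apply Finset.sum_congr rfl
  intro i _
  rw [AddMonoidAlgebra.coeff_smul_apply, smul_eq_mul]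

theorem Tm_comb {N : ℕ} (hN : 1 ≤ N) (st : Bool) {mu lam : Fin N → ℤ} (hmu : Antitone mu)
    (hlam : Antitone lam) (d d' : ℕ) (R : (Fin N → ℕ) → (Fin N → ℕ) → ℤ)
    (hR : ∀ b ∈ Idx d, (monoN b : LR N) = ∑ α ∈ Idx d, R α b • kp (cz α)) :
    ∃ n : (Fin N → ℕ) → (Fin N → ℕ) → ℤ, (∀ x y, 0 ≤ n x y) ∧
      ∀ b' ∈ Idx d', ∀ b ∈ Idx d, Tm st mu lam b' b =
        ∑ x ∈ Idx d', ∑ α ∈ Idx d, Pm b' x * n x α * R α b := by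
  have h1 : ∀ α : Fin N → ℕ, Wop st mu lam (kp (cz α)) ∈ Cn (PN (N := N)) := by
    intro α
    apply Wop_mem hN st hmu hlam
    apply kp_mem
    rintro ν σ rfl i
    simp [cz]
  have h2 := fun α => Cn_comb (d := d') (h1 α)
  choose n hn1 hn2 using h2
  refine ⟨fun x α => n α x, fun x y => hn1 _ _, fun b' hb' b hb => ?_⟩
  rw [Tm, hR b hb, map_sum]
  simp only [map_zsmul]
  rw [coeff_sum_smul, Finset.sum_comm]
  apply Finset.sum_congr rfl
  intro α _
  rw [hn2 α b' hb', Finset.mul_sum]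
  apply Finset.sum_congr rfl
  intro x _
  ring

theorem trace_nonneg {r N : ℕ} (hN : 1 ≤ N) (c : Equiv.Perm (Fin r)) (st : Fin r → Bool)
    (mu lam : Fin r → Fin N → ℤ) (hmu : ∀ s, Antitone (mu s)) (hlam : ∀ s, Antitone (lam s))
    (d : Fin r → ℕ) :
    0 ≤ ∑ b ∈ Fintype.piFinset (fun s => Idx (N := N) (d s)),
      ∏ s, Tm (st s) (mu s) (lam s) (b (c s)) (b s) := by
  classical
  have h1 := fun s => Rm_exists N (d s)
  choose R hR1 hR2 using h1
  have h2 := fun s => Tm_comb hN (st s) (hmu s) (hlam s) (d s) (d (c s)) (R s) (hR1 s)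
  choose n hn1 hn2 using h2
  exact cyclic c _ (fun _ => Pm) R n (fun s => Tm (st s) (mu s) (lam s)) hn1 hR2 hn2

theorem Tm_expand {N : ℕ} (st : Bool) (mu : Fin N → ℤ) {lam : Fin N → ℤ} (hlam : Antitone lam)
    (b' b : Fin N → ℕ) : Tm st mu lam b' b = ∑ σ : Equiv.Perm (Fin N), (Equiv.Perm.sign σ : ℤ) *
      (∏ k, H (flg st k) (mu k + (rh k - (lam + rh : Fin N → ℤ) (σ⁻¹ k)) + b k) : LR N).coeff
        (cz b') := by
  rw [Tm, Wop_apply, Dl_S hlam, Finset.mul_sum, Finset.sum_mul, map_sum]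
  have : ∀ σ : Equiv.Perm (Fin N), Qf (flg st) (mono mu * ((Equiv.Perm.sign σ : ℤ) •
      mono (fun i => rh i - (lam + rh : Fin N → ℤ) (σ⁻¹ i))) * monoN b) =
      (Equiv.Perm.sign σ : ℤ) • ∏ k, (H (flg st k)
        (mu k + (rh k - (lam + rh : Fin N → ℤ) (σ⁻¹ k)) + b k) : LR N) := by
    intro σ
    rw [mul_smul_comm, smul_mul_assoc, map_zsmul, mono_mul, monoN, mono_mul, Qf_mono]
    rfl
  simp only [this]
  rw [coeff_sum_smul]

end

section
/-- matrices supported on a flag with prescribed column and row sums -/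
noncomputable def Acol {N : ℕ} (fl : Fin N → Finset (Fin N)) (c : Fin N → ℤ) (b : Fin N → ℕ) :
    Finset (Fin N → Fin N → ℕ) :=
  (Fintype.piFinset (fun k => if 0 ≤ c k then Finset.piAntidiag (fl k) (c k).toNat else ∅)).filter
    (fun A => ∀ j, ∑ k, A k j = b j)

theorem mem_Acol {N : ℕ} {fl : Fin N → Finset (Fin N)} {c : Fin N → ℤ} {b : Fin N → ℕ}
    {A : Fin N → Fin N → ℕ} : A ∈ Acol fl c b ↔
      (∀ k j, A k j ≠ 0 → j ∈ fl k) ∧ (∀ k, ∑ j, (A k j : ℤ) = c k) ∧ ∀ j, ∑ k, A k j = b j := by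
  rw [Acol, Finset.mem_filter, Fintype.mem_piFinset, ← and_assoc]
  apply and_congr_left'
  rw [← forall_and]
  apply forall_congr'
  intro k
  have hs : (∀ j, A k j ≠ 0 → j ∈ fl k) → ∑ j ∈ fl k, A k j = ∑ j, A k j := by
    intro h
    apply Finset.sum_subset (Finset.subset_univ _)
    intro j _ hj
    by_contra h2
    exact hj (h j h2)
  split_ifs with h
  · rw [Finset.mem_piAntidiag]
    constructor
    · rintro ⟨h1, h2⟩
      refine ⟨fun j hj => h2 j hj, ?_⟩
      have h3 := hs h2
      have h1 : ∑ j ∈ fl k, A k j = (c k).toNat := h1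
      rw [h3] at h1
      rw [← Nat.cast_sum, h1, Int.toNat_of_nonneg h]
    · rintro ⟨h1, h2⟩
      refine ⟨?_, fun j hj => h1 j hj⟩
      show ∑ j ∈ fl k, A k j = _
      rw [hs h1]
      rw [← Nat.cast_sum] at h2
      omega
  · constructor
    · intro h1; simp at h1
    · rintro ⟨_, h2⟩
      exfalso; apply h; rw [← h2]; positivity

theorem prod_monoN {N : ℕ} {ι : Type*} (s : Finset ι) (F : ι → Fin N → ℕ) :
    ∏ i ∈ s, (monoN (F i) : LR N) = mono (cz (fun j => ∑ i ∈ s, F i j)) := by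
  classical
  induction s using Finset.induction_on with
  | empty =>
    rw [Finset.prod_empty, ← mono_zero]; congr 1
  | insert a s ha ih =>
    rw [Finset.prod_insert ha, ih, monoN, mono_mul]; congr 1; ext j
    simp [cz, Finset.sum_insert ha]

theorem coeff_prod_H {N : ℕ} (fl : Fin N → Finset (Fin N)) (c : Fin N → ℤ) (b : Fin N → ℕ) :
    (∏ k, H (fl k) (c k) : LR N).coeff (cz b) = ((Acol fl c b).card : ℤ) := by
  have h1 : ∀ k, (H (fl k) (c k) : LR N) =
      ∑ a ∈ (if 0 ≤ c k then Finset.piAntidiag (fl k) (c k).toNat else ∅), monoN a := by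
    intro k; rw [H]; split_ifs <;> simp
  rw [Finset.prod_congr rfl fun k _ => h1 k, Finset.prod_univ_sum, AddMonoidAlgebra.coeff_sum,
    Finset.sum_apply']
  simp only [prod_monoN, coeff_mono]
  rw [Acol, Finset.card_filter]
  push_cast
  apply Finset.sum_congr rfl
  intro A _
  congr 1
  apply propext
  constructor
  · intro h; exact congrFun (cz_inj h)
  · intro h; congr 1; ext j; exact h j

/-- successor residue -/
def nx (r : ℕ) : Equiv.Perm (Fin r) := finRotate r

theorem nx_val {r : ℕ} (s : Fin r) : ((nx r s : Fin r) : ℕ) = ((s : ℕ) + 1) % r := by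
  cases r with
  | zero => exact s.elim0
  | succ n => rw [nx, finRotate_succ_apply, Fin.val_add]; simp

def stb {r : ℕ} (s : Fin r) : Bool := decide ((s : ℕ) = 0)

/-- the pair attached to a triple of indices -/
def pr {r N : ℕ} (s : Fin r) (k j : Fin N) : ℕ × ℕ :=
  (r * (j : ℕ) + s + 1, r * (k : ℕ) + (nx r s : Fin r) + 1)

theorem euc {r a b s t : ℕ} (hs : s < r) (ht : t < r) (h : r * a + s = r * b + t) :
    a = b ∧ s = t := by
  have h1 : (r * a + s) % r = s := by rw [Nat.mul_add_mod, Nat.mod_eq_of_lt hs]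
  have h2 : (r * b + t) % r = t := by rw [Nat.mul_add_mod, Nat.mod_eq_of_lt ht]
  have h3 : s = t := by rw [← h1, ← h2, h]
  subst h3
  refine ⟨Nat.eq_of_mul_eq_mul_left (by omega : 0 < r) (by omega), rfl⟩

theorem pr_inj {r N : ℕ} {s s' : Fin r} {k k' j j' : Fin N} (h : pr s k j = pr s' k' j') :
    s = s' ∧ k = k' ∧ j = j' := by
  rw [pr, pr, Prod.mk.injEq] at h
  obtain ⟨h1, h2⟩ := h
  have h3 := euc s.isLt s'.isLt (Nat.succ_injective h1)
  have h4 := euc (nx r s).isLt (nx r s').isLt (Nat.succ_injective h2)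
  exact ⟨Fin.ext h3.2, Fin.ext h4.1, Fin.ext h3.1⟩

theorem lt_mul_lem {r a b : ℕ} (h : a < b) : r * a + r ≤ r * b := by
  calc r * a + r = r * (a + 1) := by ring
    _ ≤ r * b := Nat.mul_le_mul_left r h

theorem pr_pseudo {r N : ℕ} (s : Fin r) (k j : Fin N) :
    PseudoPair r N (pr s k j) ↔ j ∈ flg (stb (nx r s)) k := by
  have hs := s.isLt
  have hk := lt_mul_lem (r := r) k.isLt
  have hn := nx_val s
  have hnl := (nx r s).isLt
  have hmod : (r * (k : ℕ) + (nx r s : Fin r) + 1) % r = (r * (j : ℕ) + s + 1 + 1) % r := by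
    rw [hn, add_assoc, add_assoc, add_assoc, Nat.mul_add_mod, Nat.mul_add_mod, Nat.mod_add_mod,
      ← add_assoc]
  have h1 : PseudoPair r N (pr s k j) ↔ r * (j : ℕ) + s < r * (k : ℕ) + (nx r s : Fin r) := by
    unfold PseudoPair pr
    simp only
    constructor
    · rintro ⟨_, h, _⟩; omega
    · intro h; exact ⟨by omega, by omega, by omega, hmod⟩
  rw [h1]
  by_cases hsr : (s : ℕ) + 1 < r
  · rw [Nat.mod_eq_of_lt hsr] at hn
    have : stb (nx r s) = false := by simp [stb, hn]
    rw [this, hn]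
    simp only [flg, Bool.false_eq_true, if_false, Finset.mem_Iic]
    rw [Fin.le_def]
    constructor
    · intro h; by_contra h2
      have := lt_mul_lem (r := r) (not_le.mp h2); omega
    · intro h
      have := Nat.mul_le_mul_left r h; omega
  · have e : (s : ℕ) + 1 = r := by omega
    rw [e, Nat.mod_self] at hn
    have : stb (nx r s) = true := by simp [stb, hn]
    rw [this, hn]
    simp only [flg, if_true, Finset.mem_Iio]
    rw [Fin.lt_def]
    constructor
    · intro h; by_contra h2
      have := Nat.mul_le_mul_left r (not_lt.mp h2); omega
    · intro h
      have := lt_mul_lem (r := r) h; omega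

theorem pseudo_pr {r N : ℕ} {p : ℕ × ℕ} (hr : 1 ≤ r) (h : PseudoPair r N p) :
    ∃ (s : Fin r) (k j : Fin N), pr s k j = p := by
  obtain ⟨m, n⟩ := p
  obtain ⟨h1, h2, h3, h4⟩ := h
  simp only at h1 h2 h3 h4
  have hj : (m - 1) / r < N := (Nat.div_lt_iff_lt_mul hr).mpr (by rw [mul_comm]; omega)
  have hk : (n - 1) / r < N := (Nat.div_lt_iff_lt_mul hr).mpr (by rw [mul_comm]; omega)
  refine ⟨⟨(m - 1) % r, Nat.mod_lt _ hr⟩, ⟨(n - 1) / r, hk⟩, ⟨(m - 1) / r, hj⟩, ?_⟩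
  rw [pr, nx_val]
  simp only
  have e1 := Nat.div_add_mod (m - 1) r
  have e2 := Nat.div_add_mod (n - 1) r
  have e3 : ((m - 1) % r + 1) % r = (n - 1) % r := by
    rw [Nat.mod_add_mod, Nat.sub_add_cancel h1]
    have : (n - 1) + 1 ≡ m + 1 [MOD r] := by
      rw [Nat.sub_add_cancel (by omega)]; exact h4
    exact (Nat.ModEq.add_right_cancel' 1 this).symm
  rw [e3, e1, e2, Prod.mk.injEq]
  omega

/-- multiset of pairs attached to a family of matrices -/
def toM {r N : ℕ} (A : Fin r → Fin N → Fin N → ℕ) : Multiset (ℕ × ℕ) :=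
  ∑ s, ∑ k, ∑ j, A s k j • {pr s k j}

def fromM {r N : ℕ} (M : Multiset (ℕ × ℕ)) : Fin r → Fin N → Fin N → ℕ :=
  fun s k j => M.count (pr s k j)

theorem toM_hom {r N : ℕ} {G : Type*} [AddCommMonoid G] (h : Multiset (ℕ × ℕ) →+ G)
    (A : Fin r → Fin N → Fin N → ℕ) :
    h (toM A) = ∑ s, ∑ k, ∑ j, A s k j • h {pr s k j} := by
  simp [toM, map_sum, map_nsmul]

theorem sum3_single {r N : ℕ} {G : Type*} [AddCommMonoid G] (F : Fin r → Fin N → Fin N → G)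
    (s : Fin r) (k j : Fin N) (h : ∀ s' k' j', ¬ (s' = s ∧ k' = k ∧ j' = j) → F s' k' j' = 0) :
    ∑ s', ∑ k', ∑ j', F s' k' j' = F s k j := by
  rw [Finset.sum_eq_single s, Finset.sum_eq_single k, Finset.sum_eq_single j]
  · intro j' _ hj; exact h _ _ _ fun h => hj h.2.2
  · simp
  · intro k' _ hk; exact Finset.sum_eq_zero fun j' _ => h _ _ _ fun h => hk h.2.1
  · simp
  · intro s' _ hs
    exact Finset.sum_eq_zero fun k' _ => Finset.sum_eq_zero fun j' _ => h _ _ _ fun h => hs h.1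
  · simp

theorem count_toM {r N : ℕ} (A : Fin r → Fin N → Fin N → ℕ) (p : ℕ × ℕ) :
    (toM A).count p = ∑ s, ∑ k, ∑ j, A s k j * if p = pr s k j then 1 else 0 := by
  have := toM_hom (Multiset.countAddMonoidHom p) A
  simp only [Multiset.coe_countAddMonoidHom, Multiset.count_singleton, smul_eq_mul] at this
  exact this

theorem fromM_toM {r N : ℕ} (A : Fin r → Fin N → Fin N → ℕ) : fromM (toM A) = A := by
  ext s k j
  rw [fromM, count_toM, sum3_single _ s k j]
  · simp
  · intro s' k' j' h
    rw [if_neg, mul_zero]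
    intro h2
    obtain ⟨rfl, rfl, rfl⟩ := pr_inj h2
    exact h ⟨rfl, rfl, rfl⟩

theorem toM_fromM {r N : ℕ} (hr : 1 ≤ r) {M : Multiset (ℕ × ℕ)} (hM : ∀ p ∈ M, PseudoPair r N p) :
    toM (fromM M : Fin r → Fin N → Fin N → ℕ) = M := by
  ext p
  by_cases hp : p ∈ M
  · obtain ⟨s, k, j, rfl⟩ := pseudo_pr hr (hM p hp)
    show fromM (toM (fromM M)) s k j = _
    rw [fromM_toM]; rfl
  · rw [Multiset.count_eq_zero_of_notMem hp, count_toM]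
    apply Finset.sum_eq_zero; intro s _
    apply Finset.sum_eq_zero; intro k _
    apply Finset.sum_eq_zero; intro j _
    split_ifs with h
    · subst h
      rw [fromM, Multiset.count_eq_zero_of_notMem hp, zero_mul]
    · simp

theorem mem_toM {r N : ℕ} {A : Fin r → Fin N → Fin N → ℕ} {p : ℕ × ℕ} :
    p ∈ toM A ↔ ∃ s k j, A s k j ≠ 0 ∧ p = pr s k j := by
  simp only [toM, Multiset.mem_sum, Finset.mem_univ, true_and, Multiset.mem_nsmul,
    Multiset.mem_singleton]

theorem dCount_toM {r N : ℕ} (A : Fin r → Fin N → Fin N → ℕ) (s : Fin r) :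
    dCount r (toM A) s = ∑ j, ∑ k, A s k j := by
  have h0 : dCount r (toM A) s =
      Multiset.countPAddMonoidHom (fun p : ℕ × ℕ => p.1 % r = ((s : ℕ) + 1) % r) (toM A) := by
    rw [dCount, Multiset.coe_countPAddMonoidHom, Multiset.countP_eq_card_filter]
  rw [h0, toM_hom]
  have h1 : ∀ (s' : Fin r) (k j : Fin N), Multiset.countPAddMonoidHom
      (fun p : ℕ × ℕ => p.1 % r = ((s : ℕ) + 1) % r) {pr s' k j} = if s' = s then 1 else 0 := by
    intro s' k j
    rw [Multiset.coe_countPAddMonoidHom, ← Multiset.cons_zero, Multiset.countP_cons,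
      Multiset.countP_zero, zero_add]
    congr 1
    apply propext
    rw [pr]
    simp only
    rw [add_assoc, Nat.mul_add_mod]
    constructor
    · intro h
      have h2 : (s' : ℕ) ≡ s [MOD r] := Nat.ModEq.add_right_cancel' 1 h
      exact Fin.ext (by rwa [Nat.ModEq, Nat.mod_eq_of_lt s'.isLt, Nat.mod_eq_of_lt s.isLt] at h2)
    · rintro rfl; rfl
  simp only [h1]
  rw [Finset.sum_eq_single s]
  · simp only [if_true, smul_eq_mul, mul_one]
    exact Finset.sum_comm
  · intro s' _ hs; simp [hs]
  · simp

theorem pos_surj {r N : ℕ} (i : Fin (r * N)) : ∃ s j, i = pos r N s j :=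
  ⟨⟨(i : ℕ) % r, mod_lt_of_fin i⟩, ⟨(i : ℕ) / r, div_lt_of_fin i⟩, Fin.ext (by
    simp only [pos]; exact (Nat.div_add_mod _ _).symm)⟩

theorem stdVec_pos {r N : ℕ} (s s' : Fin r) (j j' : Fin N) :
    stdVec r N (r * (j' : ℕ) + s' + 1) (pos r N s j) = if s' = s ∧ j' = j then 1 else 0 := by
  rw [stdVec]
  congr 1
  apply propext
  simp only [pos]
  constructor
  · intro h
    have := euc s.isLt s'.isLt (Nat.succ_injective h)
    exact ⟨Fin.ext this.2.symm, Fin.ext this.1.symm⟩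
  · rintro ⟨rfl, rfl⟩; rfl

theorem vec_toM {r N : ℕ} (A : Fin r → Fin N → Fin N → ℕ) (s : Fin r) (k : Fin N) :
    ((toM A).map (prVec r N)).sum (pos r N (nx r s) k) =
      ∑ k', (A (nx r s) k' k : ℤ) - ∑ j, (A s k j : ℤ) := by
  have h0 := toM_hom (Multiset.sumAddMonoidHom.comp (Multiset.mapAddMonoidHom (prVec r N))) A
  have h1 : ((toM A).map (prVec r N)).sum = ∑ s, ∑ k, ∑ j, A s k j • prVec r N (pr s k j) := by
    simpa using h0
  rw [h1]
  simp only [Finset.sum_apply, Pi.smul_apply, prVec, Pi.sub_apply, pr, stdVec_pos, smul_sub,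
    Finset.sum_sub_distrib]
  congr 1
  · rw [Finset.sum_eq_single (nx r s)]
    · apply Finset.sum_congr rfl
      intro k' _
      rw [Finset.sum_eq_single k]
      · simp
      · intro j _ hj; simp [hj]
      · simp
    · intro s' _ hs; simp [hs]
    · simp
  · rw [Finset.sum_eq_single s]
    · rw [Finset.sum_eq_single k]
      · simp
      · intro k' _ hk; simp [hk]
      · simp
    · intro s' _ hs; simp [hs]
    · simp

theorem isDecomp_toM {r N : ℕ} (β : Fin (r * N) → ℤ) (A : Fin r → Fin N → Fin N → ℕ) :
    IsDecomp r N β (toM A) ↔ (∀ s k j, A s k j ≠ 0 → j ∈ flg (stb (nx r s)) k) ∧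
      ∀ s k, β (pos r N (nx r s) k) = ∑ k', (A (nx r s) k' k : ℤ) - ∑ j, (A s k j : ℤ) := by
  rw [IsDecomp]
  apply and_congr
  · constructor
    · intro h s k j hA
      rw [← pr_pseudo]; exact h _ (mem_toM.mpr ⟨s, k, j, hA, rfl⟩)
    · intro h p hp
      obtain ⟨s, k, j, hA, rfl⟩ := mem_toM.mp hp
      rw [pr_pseudo]; exact h _ _ _ hA
  · constructor
    · rintro rfl s k; exact vec_toM A s k
    · intro h
      funext i
      obtain ⟨s, j, rfl⟩ := pos_surj i
      obtain ⟨s', rfl⟩ := (nx r).surjective s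
      rw [h, vec_toM]

end

section
/-- linear weight -/
noncomputable def wt {n : ℕ} : (Fin n → ℤ) →+ ℤ where
  toFun v := ∑ i : Fin n, ((i : ℕ) : ℤ) * v i
  map_zero' := by simp
  map_add' u v := by simp [mul_add, Finset.sum_add_distrib]

theorem wt_stdVec {r N m : ℕ} (h1 : 1 ≤ m) (h2 : m ≤ r * N) : wt (stdVec r N m) = (m : ℤ) - 1 := by
  show ∑ i : Fin (r * N), ((i : ℕ) : ℤ) * stdVec r N m i = _
  rw [Finset.sum_eq_single ⟨m - 1, by omega⟩]
  · simp only [stdVec]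
    rw [if_pos (by omega)]
    push_cast [h1]; ring
  · intro i _ hi
    rw [stdVec, if_neg, mul_zero]
    intro h; apply hi; exact Fin.ext (by simp; omega)
  · simp

theorem wt_card {r N : ℕ} (M : Multiset (ℕ × ℕ)) (h : ∀ p ∈ M, PseudoPair r N p) :
    wt ((M.map (prVec r N)).sum) ≤ - (Multiset.card M : ℤ) := by
  induction M using Multiset.induction_on with
  | empty => simp
  | cons p M ih =>
    have h1 := ih fun q hq => h q (Multiset.mem_cons_of_mem hq)
    obtain ⟨a, b, c, _⟩ := h p (Multiset.mem_cons_self p M)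
    rw [Multiset.map_cons, Multiset.sum_cons, map_add, prVec, map_sub, wt_stdVec a (by omega),
      wt_stdVec (by omega) c, Multiset.card_cons]
    push_cast
    omega

theorem finite_decomp {r N : ℕ} (hr : 1 ≤ r) (β : Fin (r * N) → ℤ) :
    {M | IsDecomp r N β M}.Finite := by
  refine Set.Finite.subset ((Set.finite_Iic
    (fun (_ : Fin r) (_ : Fin N) (_ : Fin N) => (-(wt β)).toNat)).image toM) ?_
  rintro M ⟨h1, h2⟩
  refine ⟨fromM M, ?_, toM_fromM hr h1⟩
  rw [Set.mem_Iic]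
  intro s k j
  have := wt_card M h1
  rw [h2] at this
  have h3 : fromM M s k j ≤ Multiset.card M := Multiset.count_le_card _ _
  show fromM M s k j ≤ (-(wt β)).toNat
  omega

theorem coeff_dMono {r : ℕ} (M : Multiset (ℕ × ℕ)) (d : Fin r →₀ ℕ) :
    MvPolynomial.coeff d (dMono r M) = if (∀ s, dCount r M s = d s) then 1 else 0 := by
  classical
  have : dMono r M = MvPolynomial.monomial (Finsupp.equivFunOnFinite.symm (dCount r M)) 1 := by
    rw [MvPolynomial.monomial_eq, Finsupp.prod_fintype _ _ (by simp)]
    simp [dMono]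
  rw [this, MvPolynomial.coeff_monomial]
  congr 1
  apply propext
  rw [DFunLike.ext_iff]
  rfl

theorem coeff_Lmv {r N : ℕ} (hr : 1 ≤ r) (β : Fin (r * N) → ℤ) (d : Fin r →₀ ℕ) :
    MvPolynomial.coeff d (Lmv r N β) =
      ∑ b ∈ Fintype.piFinset (fun s => Idx (N := N) (d s)),
        ∏ s, (∏ k, H (flg (stb (nx r s)) k)
          ((b (nx r s) k : ℤ) - β (pos r N (nx r s) k)) : LR N).coeff (cz (b s)) := by
  classical
  simp only [coeff_prod_H]
  have hfin := finite_decomp hr β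
  rw [Lmv, finsum_mem_eq_finite_toFinset_sum _ hfin, MvPolynomial.coeff_sum]
  simp only [coeff_dMono]
  rw [Finset.sum_boole]
  have e : ∀ b : Fin r → Fin N → ℕ, ∏ s, ((Acol (flg (stb (nx r s)))
      (fun k => (b (nx r s) k : ℤ) - β (pos r N (nx r s) k)) (b s)).card : ℤ) =
      ((Fintype.piFinset fun s => Acol (flg (stb (nx r s)))
      (fun k => (b (nx r s) k : ℤ) - β (pos r N (nx r s) k)) (b s)).card : ℤ) := by
    intro b; rw [Fintype.card_piFinset]; push_cast; rfl
  rw [Finset.sum_congr rfl fun b _ => e b, ← Nat.cast_sum, ← Finset.card_sigma]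
  congr 1
  refine Finset.card_bij'
    (fun M _ => ⟨fun s j => ∑ k, fromM M s k j, fromM M⟩) (fun x _ => toM x.2) ?_ ?_ ?_ ?_
  · intro M hM
    simp only [Finset.mem_filter, Set.Finite.mem_toFinset, Set.mem_setOf_eq] at hM
    obtain ⟨hM, hd⟩ := hM
    have hM2 := toM_fromM hr hM.1
    rw [← hM2, isDecomp_toM] at hM
    simp only [Finset.mem_sigma, Fintype.mem_piFinset, mem_Idx, mem_Acol]
    refine ⟨fun s => ?_, fun s => ⟨hM.1 s, fun k => ?_, fun j => trivial⟩⟩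
    · rw [← dCount_toM, hM2, hd]
    · rw [hM.2 s k]; push_cast; ring
  · rintro ⟨b, A⟩ hx
    simp only [Finset.mem_sigma, Fintype.mem_piFinset, mem_Idx, mem_Acol] at hx
    obtain ⟨h1, h2⟩ := hx
    simp only [Finset.mem_filter, Set.Finite.mem_toFinset, Set.mem_setOf_eq]
    rw [isDecomp_toM]
    refine ⟨⟨fun s => (h2 s).1, fun s k => ?_⟩, fun s => ?_⟩
    · rw [(h2 s).2.1 k, ← Nat.cast_sum, (h2 (nx r s)).2.2 k]; ring
    · rw [dCount_toM, ← h1 s]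
      exact Finset.sum_congr rfl fun j _ => (h2 s).2.2 j
  · intro M hM
    simp only [Finset.mem_filter, Set.Finite.mem_toFinset, Set.mem_setOf_eq] at hM
    exact toM_fromM hr hM.1.1
  · rintro ⟨b, A⟩ hx
    simp only [Finset.mem_sigma, Fintype.mem_piFinset, mem_Idx, mem_Acol] at hx
    have : b = fun s j => ∑ k, A s k j := by
      funext s j; exact ((hx.2 s).2.2 j).symm
    subst this
    simp only [fromM_toM]

theorem permAct_pos {r N : ℕ} (σ : Fin r → Equiv.Perm (Fin N)) (ν : Fin (r * N) → ℤ) (s : Fin r)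
    (j : Fin N) : permAct r N σ ν (pos r N s j) = ν (pos r N s ((σ s)⁻¹ j)) := by
  have h1 : (r * (j : ℕ) + s) % r = s := by rw [Nat.mul_add_mod, Nat.mod_eq_of_lt s.isLt]
  have h2 : (r * (j : ℕ) + s) / r = j := by
    rw [Nat.mul_add_div (by have := s.isLt; omega), Nat.div_eq_of_lt s.isLt, add_zero]
  have e1 : (⟨((pos r N s j : Fin (r * N)) : ℕ) % r, mod_lt_of_fin _⟩ : Fin r) = s := Fin.ext h1
  have e2 : (⟨((pos r N s j : Fin (r * N)) : ℕ) / r, div_lt_of_fin _⟩ : Fin N) = j := Fin.ext h2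
  unfold permAct
  rw [e1, e2]

theorem rhoVec_pos {r N : ℕ} (s : Fin r) (j : Fin N) : rhoVec r N (pos r N s j) = rh j := by
  have h2 : (r * (j : ℕ) + s) / r = j := by
    rw [Nat.mul_add_div (by have := s.isLt; omega), Nat.div_eq_of_lt s.isLt, add_zero]
  simp only [rhoVec, pos, rh, h2]

theorem coeff_Kmv {r N : ℕ} (hr : 1 ≤ r) (lam mu : Fin (r * N) → ℤ) (hlam : IsMP r N lam)
    (d : Fin r →₀ ℕ) : MvPolynomial.coeff d (Kmv r N lam mu) =
      ∑ b ∈ Fintype.piFinset (fun s => Idx (N := N) (d s)),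
        ∏ s, Tm (stb s) (fun j => mu (pos r N s j)) (fun j => lam (pos r N s j))
          (b ((nx r).symm s)) (b s) := by
  classical
  have hl : ∀ s, Antitone (fun j => lam (pos r N s j)) := fun s j k h => hlam s j k h
  rw [Kmv, MvPolynomial.coeff_sum]
  simp only [MvPolynomial.coeff_C_mul, coeff_Lmv hr]
  have h1 : ∀ b : Fin r → Fin N → ℕ,
      ∏ s, Tm (stb s) (fun j => mu (pos r N s j)) (fun j => lam (pos r N s j))
          (b ((nx r).symm s)) (b s) = ∑ σ : Fin r → Equiv.Perm (Fin N), signProd r N σ *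
        ∏ s, (∏ k, H (flg (stb (nx r s)) k)
          ((b (nx r s) k : ℤ) - (permAct r N σ (lam + rhoVec r N) - rhoVec r N - mu)
            (pos r N (nx r s) k)) : LR N).coeff (cz (b s)) := by
    intro b
    simp only [Tm_expand _ _ (hl _)]
    rw [Finset.prod_univ_sum, Fintype.piFinset_univ]
    apply Finset.sum_congr rfl
    intro σ _
    rw [Finset.prod_mul_distrib, signProd]
    congr 1
    rw [← Equiv.prod_comp (nx r)]
    apply Finset.prod_congr rfl
    intro s _
    rw [Equiv.symm_apply_apply]
    congr 2
    apply Finset.prod_congr rfl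
    intro k _
    congr 1
    simp only [Pi.sub_apply, Pi.add_apply, permAct_pos, rhoVec_pos]
    ring
  rw [Finset.sum_congr rfl fun b _ => h1 b, Finset.sum_comm]
  simp only [Finset.mul_sum]

theorem main_nonneg (r N : ℕ) (hr : 1 ≤ r) (hN : 1 ≤ N)
    (lam mu : Fin (r * N) → ℤ) (hlam : IsMP r N lam) (hmu : IsMP r N mu) :
    ∀ d : Fin r →₀ ℕ, 0 ≤ MvPolynomial.coeff d (Kmv r N lam mu) := by
  intro d
  rw [coeff_Kmv hr lam mu hlam d]
  exact trace_nonneg hN (nx r).symm stb (fun s j => mu (pos r N s j))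
    (fun s j => lam (pos r N s j)) (fun s j k h => hmu s j k h) (fun s j k h => hlam s j k h) d

end

/-- for a regular multipartition `μ` and a multipartition `λ ≥ μ`,
the multivariable Kostka–Shoji polynomial `K_{λμ}(t_1, …, t_r)` has nonnegative
integer coefficients. -/
theorem stmt0 (r N : ℕ) (hr : 1 ≤ r) (hN : 1 ≤ N)
    (lam mu : Fin (r * N) → ℤ)
    (hlam : IsMP r N lam) (hmu : IsMP r N mu)
    (hreg : RegularMP r N mu)
    (hdom : Dominates r N lam mu) :
    ∀ d : Fin r →₀ ℕ, 0 ≤ MvPolynomial.coeff d (Kmv r N lam mu) := by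
  exact main_nonneg r N hr hN lam mu hlam hmu

end KS
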